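/- (Newton relations, symmetric form.) Let R̂ be a Hecke R-matrix for the parameter q with m_q ≠ 0 for all m ≥ 1, let F̂ be a closed R-matrix compatible with R̂, and let M be a matrix of generators of M(R̂,F̂) over a unital associative k-algebra A. Then for every k ≥ 1: k_q τ_k(M) = Σ_{i=0}^{k−1} q^{−i} s_{k−i}(M) τ_i(M) in A. -/

import Mathlib

/-! Common definitions for quantum matrix algebras `M(R̂,F̂)` in the sense of
Isaev–Ogievetsky–Pyatov, "On quantum matrix algebras satisfying the
Cayley-Hamilton-Newton identities".

We model operators on `V^{⊗m}` (where `dim V = N`) as matrices indexed by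
multi-indices `Fin m → Fin N`; entries are taken in a (possibly
noncommutative) unital associative algebra `A` over a field `K`.
Sites (tensor factors) are numbered starting from `0`, so the paper's
`X_i` is `site m (i-1) X`, and the paper's `M_{\overline{k}}` is
`Mbar m F F⁻¹ M (k-1)`. -/

namespace CHN

noncomputable section

/-- Operators on `V^{⊗m}` (`dim V = N`) with entries in a ring `A`. -/
abbrev Op (N : ℕ) (A : Type*) [Ring A] (m : ℕ) :=
  Matrix (Fin m → Fin N) (Fin m → Fin N) A

/-- Operators on `V ⊗ V`. -/
abbrev M2 (N : ℕ) (A : Type*) [Ring A] :=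
  Matrix (Fin N × Fin N) (Fin N × Fin N) A

/-- `site m i X` places the two-site operator `X` at the (0-based) tensor
factors `i, i+1` of `V^{⊗m}`, acting as the identity elsewhere.  In the
paper's 1-based notation, `X_i = site m (i-1) X`.  (Out of range it is the
identity.) -/
def site {A : Type*} [Ring A] {N : ℕ} (m i : ℕ) (X : M2 N A) : Op N A m :=
  fun a b =>
    if h : i + 1 < m then
      X (a ⟨i, Nat.lt_of_succ_lt h⟩, a ⟨i + 1, h⟩)
          (b ⟨i, Nat.lt_of_succ_lt h⟩, b ⟨i + 1, h⟩) *
        (if ∀ j : Fin m, (j : ℕ) ≠ i → (j : ℕ) ≠ i + 1 → a j = b j then 1 else 0)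
    else if a = b then 1 else 0

/-- `site1 m i X` places the one-site operator `X` at the (0-based) factor `i`. -/
def site1 {A : Type*} [Ring A] {N : ℕ} (m i : ℕ) (X : Matrix (Fin N) (Fin N) A) :
    Op N A m :=
  fun a b =>
    if h : i < m then
      X (a ⟨i, h⟩) (b ⟨i, h⟩) *
        (if ∀ j : Fin m, (j : ℕ) ≠ i → a j = b j then 1 else 0)
    else if a = b then 1 else 0

/-- `chain m X i l = X_i X_{i+1} ⋯ X_{i+l-1}` (0-based sites, `l` factors); in
the paper's 1-based notation this is `X_{i+1 → i+l}`. -/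
def chain {A : Type*} [Ring A] {N : ℕ} (m : ℕ) (X : M2 N A) (i : ℕ) :
    ℕ → Op N A m
  | 0 => 1
  | l + 1 => chain m X i l * site m (i + l) X

/-- The Yang–Baxter equation `X₁X₂X₁ = X₂X₁X₂` on `V^{⊗3}`. -/
def YB {A : Type*} [Ring A] {N : ℕ} (X : M2 N A) : Prop :=
  site 3 0 X * site 3 1 X * site 3 0 X = site 3 1 X * site 3 0 X * site 3 1 X

/-- Compatibility of a pair of R-matrices: both Yang–Baxter equations together
with the conditions `R̂₁F̂₂F̂₁ = F̂₂F̂₁R̂₂` and `F̂₁F̂₂R̂₁ = R̂₂F̂₁F̂₂` on `V^{⊗3}`. -/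
def Compatible {A : Type*} [Ring A] {N : ℕ} (R F : M2 N A) : Prop :=
  YB R ∧ YB F ∧
    site 3 0 R * site 3 1 F * site 3 0 F = site 3 1 F * site 3 0 F * site 3 1 R ∧
    site 3 0 F * site 3 1 F * site 3 0 R = site 3 1 R * site 3 0 F * site 3 1 F

/-- `Ψ` witnesses closedness of `F̂`:  `Ψ^{af}_{cg} F̂^{gb}_{fd} = δ^a_d δ^b_c`. -/
def IsClosedPair {A : Type*} [Ring A] {N : ℕ} (F Ψ : M2 N A) : Prop :=
  ∀ a b c d : Fin N,
    (∑ f : Fin N, ∑ g : Fin N, Ψ (a, f) (c, g) * F (g, b) (f, d)) =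
      if a = d ∧ b = c then 1 else 0

/-- The matrix `D`, `D^a_b := Ψ^{ac}_{bc}`. -/
def Dmat {A : Type*} [Ring A] {N : ℕ} (Ψ : M2 N A) : Matrix (Fin N) (Fin N) A :=
  fun a b => ∑ c : Fin N, Ψ (a, c) (b, c)

/-- Quantum trace (with weight `D`) over the last tensor factor. -/
def qtr1 {K : Type*} [Field K] {A : Type*} [Ring A] [Algebra K A] {N m : ℕ}
    (D : Matrix (Fin N) (Fin N) K) (X : Op N A (m + 1)) : Op N A m :=
  fun a b => ∑ c : Fin N, ∑ e : Fin N,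
    algebraMap K A (D c e) * X (Fin.snoc a e) (Fin.snoc b c)

/-- Quantum trace over the last `j` tensor factors. -/
def qtrs {K : Type*} [Field K] {A : Type*} [Ring A] [Algebra K A] {N : ℕ}
    (D : Matrix (Fin N) (Fin N) K) (m : ℕ) :
    (j : ℕ) → Op N A (m + j) → Op N A m
  | 0, X => X
  | j + 1, X => qtrs D m j (qtr1 D X)

/-- Full quantum trace `Tr_F(1,…,m)`, with values in `A`. -/
def qtrAll {K : Type*} [Field K] {A : Type*} [Ring A] [Algebra K A] {N m : ℕ}
    (D : Matrix (Fin N) (Fin N) K) (X : Op N A m) : A :=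
  ∑ a : Fin m → Fin N, ∑ b : Fin m → Fin N,
    algebraMap K A (∏ i, D (a i) (b i)) * X b a

/-- Quantum trace of a one-site operator:  `Tr_F X = Tr (D X)`. -/
def trF {K : Type*} [Field K] {A : Type*} [Ring A] [Algebra K A] {N : ℕ}
    (D : Matrix (Fin N) (Fin N) K) (X : Matrix (Fin N) (Fin N) A) : A :=
  ∑ a : Fin N, ∑ b : Fin N, algebraMap K A (D a b) * X b a

/-- Ordinary partial trace over the last tensor factor. -/
def ptr1 {A : Type*} [Ring A] {N m : ℕ} (X : Op N A (m + 1)) : Op N A m :=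
  fun a b => ∑ c : Fin N, X (Fin.snoc a c) (Fin.snoc b c)

/-- Ordinary partial trace over the last `j` tensor factors. -/
def ptrs {A : Type*} [Ring A] {N : ℕ} (m : ℕ) :
    (j : ℕ) → Op N A (m + j) → Op N A m
  | 0, X => X
  | j + 1, X => ptrs m j (ptr1 X)

/-- `Mbar m F Finv M k` is the paper's `M_{\overline{k+1}}` (0-based index `k`):
`M_{\overline{1}} := M₁` and `M_{\overline{k+1}} := F̂_k M_{\overline{k}} F̂_k⁻¹`. -/
def Mbar {A : Type*} [Ring A] {N : ℕ} (m : ℕ) (F Finv : M2 N A)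
    (M : Matrix (Fin N) (Fin N) A) : ℕ → Op N A m
  | 0 => site1 m 0 M
  | k + 1 => site m k F * Mbar m F Finv M k * site m k Finv

/-- `MbarSeg m F Finv M i l = M_{\overline{i+1}} M_{\overline{i+2}} ⋯ M_{\overline{i+l}}`,
the ordered product of `l` consecutive copies starting at 0-based index `i`.
In particular `MbarSeg m F Finv M 0 k = M_{\overline{1}} ⋯ M_{\overline{k}}`. -/
def MbarSeg {A : Type*} [Ring A] {N : ℕ} (m : ℕ) (F Finv : M2 N A)
    (M : Matrix (Fin N) (Fin N) A) (i : ℕ) : ℕ → Op N A m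
  | 0 => 1
  | l + 1 => MbarSeg m F Finv M i l * Mbar m F Finv M (i + l)

/-- The double twist `R̂^{FF} = F̂ (F̂ R̂ F̂⁻¹) F̂⁻¹`. -/
def RFF {K : Type*} [Field K] {N : ℕ} (R F : M2 N K) : M2 N K :=
  F * (F * R * F⁻¹) * F⁻¹

/-- `M` is a matrix of generators of the algebra `M(R̂,F̂)`:
`R̂₁ M_{\overline{1}} M_{\overline{2}} = M_{\overline{1}} M_{\overline{2}} (R̂^{FF})₁`
on `V ⊗ V`. -/
def IsGenerators {K : Type*} [Field K] {A : Type*} [Ring A] [Algebra K A] {N : ℕ}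
    (R F : M2 N K) (M : Matrix (Fin N) (Fin N) A) : Prop :=
  site 2 0 (R.map (algebraMap K A)) *
      MbarSeg 2 (F.map (algebraMap K A)) ((F⁻¹).map (algebraMap K A)) M 0 2 =
    MbarSeg 2 (F.map (algebraMap K A)) ((F⁻¹).map (algebraMap K A)) M 0 2 *
      site 2 0 ((RFF R F).map (algebraMap K A))

/-- Evaluation of a noncommutative polynomial `Y` in `v` variables, substituting
for the variable `x_j` the operator `R̂` placed at the (0-based) sites
`p+j, p+j+1` of `V^{⊗m}`.  For `p = 0` this is the paper's
`Y^{(v+1)} = Y^{(v+1)}(R̂₁,…,R̂_v)`, and a general `p` gives `Y^{(p+1,v+1)}`. -/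
def evalY {K : Type*} [Field K] {A : Type*} [Ring A] [Algebra K A] {N m v : ℕ}
    (R : M2 N A) (p : ℕ) (Y : FreeAlgebra K (Fin v)) : Op N A m :=
  FreeAlgebra.lift K (fun j : Fin v => site m (p + (j : ℕ)) R) Y

/-- `Ustack m R k l = R̂_{l → l+k-1} ⋯ R̂_{2 → k+1} R̂_{1 → k}` (1-based labels):
the product of `l` descending chains of length `k`. -/
def Ustack {A : Type*} [Ring A] {N : ℕ} (m : ℕ) (R : M2 N A) (k : ℕ) :
    ℕ → Op N A m
  | 0 => 1
  | l + 1 => chain m R l k * Ustack m R k l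

/-- The `q`-number `n_q = (qⁿ − q⁻ⁿ)/(q − q⁻¹)`. -/
def qInt {K : Type*} [Field K] (q : K) (n : ℕ) : K :=
  (q ^ n - q⁻¹ ^ n) / (q - q⁻¹)

/-- `R̂` is a Hecke R-matrix for the parameter `q`:  it is invertible, satisfies
the Yang–Baxter equation and the Hecke condition `R̂² = 1 + (q − q⁻¹)R̂`. -/
def IsHecke {K : Type*} [Field K] {N : ℕ} (q : K) (R : M2 N K) : Prop :=
  IsUnit R ∧ YB R ∧ R * R = 1 + (q - q⁻¹) • R

/-- The `q`-antisymmetrizer `A^{(k)}` built from `R̂`, placed at the (0-based)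
tensor factors `p, p+1, …, p+k-1` of `V^{⊗m}`. -/
def qasym {K : Type*} [Field K] {N : ℕ} (q : K) (R : M2 N K) (m p : ℕ) :
    ℕ → Op N K m
  | 0 => 1
  | 1 => 1
  | k + 2 =>
      (qInt q (k + 2))⁻¹ •
        (qasym q R m p (k + 1) *
          (q ^ (k + 1) • (1 : Op N K m) - qInt q (k + 1) • site m (p + k) R) *
          qasym q R m p (k + 1))

/-- The `q`-symmetrizer `S^{(k)}` built from `R̂`, placed at the (0-based)
tensor factors `p, p+1, …, p+k-1` of `V^{⊗m}`. -/
def qsym {K : Type*} [Field K] {N : ℕ} (q : K) (R : M2 N K) (m p : ℕ) :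
    ℕ → Op N K m
  | 0 => 1
  | 1 => 1
  | k + 2 =>
      (qInt q (k + 2))⁻¹ •
        (qsym q R m p (k + 1) *
          (q⁻¹ ^ (k + 1) • (1 : Op N K m) + qInt q (k + 1) • site m (p + k) R) *
          qsym q R m p (k + 1))

/-- The elementary symmetric function
`σ_k(M) = Tr_F(1,…,k)(A^{(k)} M_{\overline{1}}⋯M_{\overline{k}})` (with `σ_0 = 1`). -/
def sigmaF {K : Type*} [Field K] {A : Type*} [Ring A] [Algebra K A] {N : ℕ}
    (q : K) (R F Ψ : M2 N K) (M : Matrix (Fin N) (Fin N) A) (k : ℕ) : A :=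
  qtrAll (Dmat Ψ)
    ((qasym q R k 0 k).map (algebraMap K A) *
      MbarSeg k (F.map (algebraMap K A)) ((F⁻¹).map (algebraMap K A)) M 0 k)

/-- The complete symmetric function
`τ_k(M) = Tr_F(1,…,k)(S^{(k)} M_{\overline{1}}⋯M_{\overline{k}})` (with `τ_0 = 1`). -/
def tauF {K : Type*} [Field K] {A : Type*} [Ring A] [Algebra K A] {N : ℕ}
    (q : K) (R F Ψ : M2 N K) (M : Matrix (Fin N) (Fin N) A) (k : ℕ) : A :=
  qtrAll (Dmat Ψ)
    ((qsym q R k 0 k).map (algebraMap K A) *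
      MbarSeg k (F.map (algebraMap K A)) ((F⁻¹).map (algebraMap K A)) M 0 k)

/-- The power sums `s_k(M) = Tr_F(1,…,k)(R̂_{1→k−1} M_{\overline{1}}⋯M_{\overline{k}})`,
with `s_0 = 1`. -/
def sF {K : Type*} [Field K] {A : Type*} [Ring A] [Algebra K A] {N : ℕ}
    (R F Ψ : M2 N K) (M : Matrix (Fin N) (Fin N) A) : ℕ → A
  | 0 => 1
  | j + 1 =>
      qtrAll (Dmat Ψ)
        (chain (j + 1) (R.map (algebraMap K A)) 0 j *
          MbarSeg (j + 1) (F.map (algebraMap K A)) ((F⁻¹).map (algebraMap K A)) M 0 (j + 1))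

/-- The `(j+1)`-st quantum power of `M`,
`M^{\overline{j+1}} = Tr_F(2,…,j+1)(R̂_{1→j} M_{\overline{1}}⋯M_{\overline{j+1}})`,
as a one-site operator (so `MpowF R F Ψ M 0 = M₁ = M`). -/
def MpowF {K : Type*} [Field K] {A : Type*} [Ring A] [Algebra K A] {N : ℕ}
    (R F Ψ : M2 N K) (M : Matrix (Fin N) (Fin N) A) (j : ℕ) : Op N A 1 :=
  qtrs (Dmat Ψ) 1 j
    (chain (1 + j) (R.map (algebraMap K A)) 0 j *
      MbarSeg (1 + j) (F.map (algebraMap K A)) ((F⁻¹).map (algebraMap K A)) M 0 (j + 1))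

/-- The `(j+1)`-st wedge power of `M`,
`M^{∧(j+1)} = Tr_F(2,…,j+1)(A^{(j+1)} M_{\overline{1}}⋯M_{\overline{j+1}})`. -/
def MwedgeF {K : Type*} [Field K] {A : Type*} [Ring A] [Algebra K A] {N : ℕ}
    (q : K) (R F Ψ : M2 N K) (M : Matrix (Fin N) (Fin N) A) (j : ℕ) : Op N A 1 :=
  qtrs (Dmat Ψ) 1 j
    ((qasym q R (1 + j) 0 (j + 1)).map (algebraMap K A) *
      MbarSeg (1 + j) (F.map (algebraMap K A)) ((F⁻¹).map (algebraMap K A)) M 0 (j + 1))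

/-- The `(j+1)`-st symmetric power of `M`,
`M^{S(j+1)} = Tr_F(2,…,j+1)(S^{(j+1)} M_{\overline{1}}⋯M_{\overline{j+1}})`. -/
def MsymF {K : Type*} [Field K] {A : Type*} [Ring A] [Algebra K A] {N : ℕ}
    (q : K) (R F Ψ : M2 N K) (M : Matrix (Fin N) (Fin N) A) (j : ℕ) : Op N A 1 :=
  qtrs (Dmat Ψ) 1 j
    ((qsym q R (1 + j) 0 (j + 1)).map (algebraMap K A) *
      MbarSeg (1 + j) (F.map (algebraMap K A)) ((F⁻¹).map (algebraMap K A)) M 0 (j + 1))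

/-- `M^{\overline{0}} := q^{-n} n_q Tr_{(2,…,n)}(A^{(n)}) D^{-1}`, with `n = n0 + 1`
(an ordinary, non-quantum, trace over the factors `2,…,n`). -/
def MzeroF {K : Type*} [Field K] {N : ℕ} (q : K) (R Ψ : M2 N K) (n0 : ℕ) :
    Op N K 1 :=
  (q⁻¹ ^ (n0 + 1) * qInt q (n0 + 1)) •
    (ptrs 1 n0 (qasym q R (1 + n0) 0 (n0 + 1)) * site1 1 0 ((Dmat Ψ)⁻¹))

/-- The generators of the characteristic subalgebra: all elements
`α(Y^{(k)}) = Tr_F(1,…,k)(Y^{(k)} M_{\overline{1}}⋯M_{\overline{k}})`, `k ≥ 1`. -/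
def charSet {K : Type*} [Field K] {A : Type*} [Ring A] [Algebra K A] {N : ℕ}
    (R F Ψ : M2 N K) (M : Matrix (Fin N) (Fin N) A) : Set A :=
  { x : A | ∃ (v : ℕ) (Y : FreeAlgebra K (Fin v)),
      x = qtrAll (Dmat Ψ)
        (evalY (R.map (algebraMap K A)) 0 Y *
          MbarSeg (v + 1) (F.map (algebraMap K A)) ((F⁻¹).map (algebraMap K A)) M 0 (v + 1)) }

end

section AbstractSymmetrizer

variable {K B : Type*} [Field K] [Ring B] [Algebra K B]

/-- The `q`-symmetrizer on `n` strands built from the abstract braid generators `r 0, r 1, …`. -/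
noncomputable def symz (q : K) (r : ℕ → B) : ℕ → B
  | 0 => 1
  | 1 => 1
  | k + 2 =>
      (qInt q (k + 2))⁻¹ •
        (symz q r (k + 1) *
          (q⁻¹ ^ (k + 1) • (1 : B) + qInt q (k + 1) • r k) * symz q r (k + 1))

/-- `r 0, …, r (n - 2)` satisfy the defining relations of the Hecke algebra on `n` strands. -/
structure HeckeSeq (q : K) (r : ℕ → B) (n : ℕ) : Prop where
  hecke : ∀ i, i + 1 < n → r i * r i = 1 + (q - q⁻¹) • r i
  braid : ∀ i, i + 2 < n → r i * r (i + 1) * r i = r (i + 1) * r i * r (i + 1)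
  comm : ∀ i j, i + 1 < j → j + 1 < n → Commute (r i) (r j)

lemma qInt_one {q : K} (hd : q - q⁻¹ ≠ 0) : qInt q 1 = 1 := by
  simp [qInt, hd]

lemma qInt_succ_eq {q : K} (hq0 : q ≠ 0) (hd : q - q⁻¹ ≠ 0) (n : ℕ) :
    q⁻¹ ^ n + q * qInt q n = qInt q (n + 1) := by
  unfold qInt
  rw [← mul_div_assoc, eq_div_iff hd, add_mul, div_mul_cancel₀ _ hd, pow_succ, pow_succ]
  have : q * q⁻¹ = 1 := mul_inv_cancel₀ hq0
  ring_nf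

variable {q : K} {r : ℕ → B}

lemma HeckeSeq.mono {m n : ℕ} (h : HeckeSeq q r n) (hmn : m ≤ n) : HeckeSeq q r m :=
  ⟨fun i hi => h.hecke i (by omega), fun i hi => h.braid i (by omega),
    fun i j hij hj => h.comm i j hij (by omega)⟩

lemma HeckeSeq.shift {n : ℕ} (p : ℕ) (h : HeckeSeq q r (p + n)) :
    HeckeSeq q (fun i => r (p + i)) n :=
  ⟨fun i hi => h.hecke _ (by omega), fun i hi => h.braid (p + i) (by omega),
    fun i j hij hj => h.comm _ _ (by omega) (by omega)⟩

lemma HeckeSeq.rev {n : ℕ} (h : HeckeSeq q r n) : HeckeSeq q (fun i => r (n - 2 - i)) n := by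
  refine ⟨fun i hi => h.hecke _ (by omega), fun i hi => ?_,
    fun i j hij hj => (h.comm _ _ (by omega) (by omega)).symm⟩
  have e : n - 2 - i = n - 2 - (i + 1) + 1 := by omega
  simp only [e]
  exact (h.braid _ (by omega)).symm

lemma HeckeSeq.op {n : ℕ} (h : HeckeSeq q r n) :
    HeckeSeq q (fun i => MulOpposite.op (r i)) n := by
  refine ⟨fun i hi => ?_, fun i hi => ?_, fun i j hij hj => ?_⟩
  · rw [← MulOpposite.op_mul, h.hecke i hi]; simp
  · simp only [← MulOpposite.op_mul, ← mul_assoc, h.braid i hi]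
  · exact MulOpposite.op_injective.eq_iff.mpr (h.comm i j hij hj).eq.symm

lemma symz_congr {r' : ℕ → B} : ∀ {n : ℕ}, (∀ i, i + 1 < n → r i = r' i) →
    symz q r n = symz q r' n
  | 0, _ => rfl
  | 1, _ => rfl
  | n + 2, h => by
    rw [symz, symz, symz_congr (n := n + 1) fun i hi => h i (by omega), h n (by omega)]

lemma symz_op : ∀ n : ℕ,
    symz q (fun i => MulOpposite.op (r i)) n = MulOpposite.op (symz q r n)
  | 0 => rfl
  | 1 => rfl
  | n + 2 => by
    rw [symz, symz, symz_op (n + 1)]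
    simp [mul_assoc]

lemma commute_symz {x : B} : ∀ {n : ℕ}, (∀ i, i + 1 < n → Commute x (r i)) →
    Commute x (symz q r n)
  | 0, _ => Commute.one_right x
  | 1, _ => Commute.one_right x
  | n + 2, h => by
    have ih : Commute x (symz q r (n + 1)) := commute_symz fun i hi => h i (by omega)
    rw [symz]
    exact ((ih.mul_right (((Commute.one_right x).smul_right _).add_right
      ((h n (by omega)).smul_right _))).mul_right ih).smul_right _

section

variable (hq0 : q ≠ 0) (hd : q - q⁻¹ ≠ 0) (hqn : ∀ n : ℕ, 1 ≤ n → qInt q n ≠ 0)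
include hq0 hd hqn

lemma mul_symz_of_absorb {x : B} : ∀ {n : ℕ}, (∀ i, i + 1 < n → x * r i = q • x) →
    x * symz q r n = x
  | 0, _ => mul_one x
  | 1, _ => mul_one x
  | n + 2, h => by
    have ih : x * symz q r (n + 1) = x := mul_symz_of_absorb fun i hi => h i (by omega)
    rw [symz, mul_smul_comm, ← mul_assoc, ← mul_assoc, ih, mul_add, mul_smul_comm,
      mul_smul_comm, h n (by omega), mul_one, smul_smul, ← add_smul, smul_mul_assoc, ih,
      mul_comm (qInt q _) q, qInt_succ_eq hq0 hd, smul_smul, inv_mul_cancel₀ (hqn _ (by omega)),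
      one_smul]

lemma symz_mul_of_absorb {x : B} {n : ℕ} (h : ∀ i, i + 1 < n → r i * x = q • x) :
    symz q r n * x = x := by
  have := mul_symz_of_absorb (x := MulOpposite.op x) (r := fun i => MulOpposite.op (r i))
    hq0 hd hqn (n := n) fun i hi => by rw [← MulOpposite.op_mul, h i hi]; rfl
  rw [symz_op, ← MulOpposite.op_mul] at this
  exact MulOpposite.op_injective this

lemma symz_mul_gen : ∀ {n : ℕ}, HeckeSeq q r n → ∀ i, i + 1 < n →
    symz q r n * r i = q • symz q r n
  | 0, _, i, hi => by omega
  | 1, _, i, hi => by omega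
  | 2, h, i, hi => by
    obtain rfl : i = 0 := by omega
    have e : symz q r 2 = (qInt q 2)⁻¹ • (q⁻¹ • (1 : B) + r 0) := by
      simp [symz, qInt_one hd]
    rw [e, smul_mul_assoc, add_mul, h.hecke 0 hi, smul_mul_assoc, one_mul, smul_comm q]
    congr 1
    rw [smul_add, smul_smul, mul_inv_cancel₀ hq0]
    module
  | n + 3, h, i, hi => by
    have h2 : HeckeSeq q r (n + 2) := h.mono (by omega)
    have ih := symz_mul_gen h2
    rcases Nat.lt_or_ge (i + 1) (n + 2) with hlt | hge
    · rw [symz, smul_mul_assoc, mul_assoc, ih i hlt, mul_smul_comm, smul_comm]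
    obtain rfl : i = n + 1 := by omega
    set S := symz q r (n + 2) with hS
    set P := symz q r (n + 1) with hP
    set t := r n
    set u := r (n + 1)
    have hSt : S * t = q • S := ih n (by omega)
    have hSP : S * P = S :=
      mul_symz_of_absorb hq0 hd hqn fun i hi => ih i (by omega)
    have hPu : Commute u P := commute_symz fun i hi => (h.comm i (n + 1) (by omega) (by omega)).symm
    have huu : u * u = 1 + (q - q⁻¹) • u := h.hecke _ (by omega)
    have hb : t * u * t = u * t * u := h.braid n (by omega)
    have hSe : qInt q (n + 2) • S = P * (q⁻¹ ^ (n + 1) • (1 : B) + qInt q (n + 1) • t) * P := by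
      rw [hS, symz, smul_smul, mul_inv_cancel₀ (hqn _ (by omega)), one_smul]
    have key : S * (q⁻¹ ^ (n + 2) • (1 : B) + qInt q (n + 2) • u) * S =
        q⁻¹ ^ (n + 2) • (S * P) + q⁻¹ ^ (n + 1) • (S * u * P) +
          qInt q (n + 1) • (S * u * t * P) := by
      have e1 : S * S = S * P := by
        rw [hSP]; exact mul_symz_of_absorb hq0 hd hqn ih
      have e2 : S * (qInt q (n + 2) • u) * S =
          S * u * (q⁻¹ ^ (n + 1) • (1 : B) + qInt q (n + 1) • t) * P := by
        rw [mul_smul_comm, smul_mul_assoc, ← mul_smul_comm, hSe, ← mul_assoc, ← mul_assoc,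
          mul_assoc S u P, hPu.eq, ← mul_assoc, hSP]
      rw [mul_add, add_mul, e2, mul_smul_comm, mul_one, smul_mul_assoc, e1, mul_add, add_mul]
      simp only [mul_smul_comm, smul_mul_assoc, mul_one, add_assoc]
    have k1 : S * P * u = S * u * P := by rw [mul_assoc, ← hPu.eq, ← mul_assoc]
    have k2 : S * u * P * u = S * P + (q - q⁻¹) • (S * u * P) := by
      rw [mul_assoc _ P u, ← hPu.eq, ← mul_assoc, mul_assoc S u u, huu]
      simp only [mul_add, add_mul, mul_one, mul_smul_comm, smul_mul_assoc]
    have k3 : S * u * t * P * u = q • (S * u * t * P) := by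
      rw [mul_assoc _ P u, ← hPu.eq, ← mul_assoc, mul_assoc S u t, mul_assoc S (u * t) u, ← hb,
        ← mul_assoc, ← mul_assoc, hSt]
      simp only [smul_mul_assoc, mul_assoc]
    rw [symz, ← hS, key, smul_mul_assoc, smul_comm q]
    congr 1
    rw [add_mul, add_mul, smul_mul_assoc, smul_mul_assoc, smul_mul_assoc, k1, k2, k3]
    have hc : q⁻¹ ^ (n + 1) = q * q⁻¹ ^ (n + 2) := by
      rw [pow_succ _ (n + 1)]; field_simp
    have hc' : q⁻¹ ^ (n + 2) + q⁻¹ ^ (n + 1) * (q - q⁻¹) = q * q⁻¹ ^ (n + 1) := by ring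
    linear_combination (norm := module) hc • (S * P) + hc' • (S * u * P)

lemma gen_mul_symz {n : ℕ} (h : HeckeSeq q r n) (i : ℕ) (hi : i + 1 < n) :
    r i * symz q r n = q • symz q r n := by
  have := symz_mul_gen hq0 hd hqn h.op i hi
  rw [symz_op, ← MulOpposite.op_mul, ← MulOpposite.op_smul] at this
  exact MulOpposite.op_injective this

lemma symz_mul_self {n : ℕ} (h : HeckeSeq q r n) : symz q r n * symz q r n = symz q r n :=
  mul_symz_of_absorb hq0 hd hqn (symz_mul_gen hq0 hd hqn h)

lemma symz_rev {n : ℕ} (h : HeckeSeq q r n) :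
    symz q (fun i => r (n - 2 - i)) n = symz q r n := by
  have e1 : symz q (fun i => r (n - 2 - i)) n * symz q r n = symz q r n :=
    symz_mul_of_absorb hq0 hd hqn fun i hi => gen_mul_symz hq0 hd hqn h _ (by omega)
  rw [← e1]
  refine (mul_symz_of_absorb hq0 hd hqn fun i hi => ?_).symm
  have := symz_mul_gen hq0 hd hqn h.rev (n - 2 - i) (by omega)
  rwa [show n - 2 - (n - 2 - i) = i by omega] at this

/-- The recursion for the symmetrizer that adds a strand on the left. -/
lemma symz_succ_left {n : ℕ} (h : HeckeSeq q r (n + 2)) :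
    symz q r (n + 2) = (qInt q (n + 2))⁻¹ •
      (symz q (fun i => r (1 + i)) (n + 1) *
        (q⁻¹ ^ (n + 1) • (1 : B) + qInt q (n + 1) • r 0) *
        symz q (fun i => r (1 + i)) (n + 1)) := by
  have e : symz q (fun i => r (n + 2 - 2 - i)) (n + 1) = symz q (fun i => r (1 + i)) (n + 1) := by
    rw [← symz_rev hq0 hd hqn (HeckeSeq.shift 1 (h.mono (by omega)) : HeckeSeq q _ (n + 1))]
    exact symz_congr fun i hi => congrArg r (by omega)
  rw [← symz_rev hq0 hd hqn h, symz, e]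
  simp

end

/-- `r 0 * r 1 * ⋯ * r (l - 1)`. -/
def prodSeq (r : ℕ → B) : ℕ → B
  | 0 => 1
  | l + 1 => prodSeq r l * r l

lemma commute_prodSeq {x : B} : ∀ {n : ℕ}, (∀ i, i < n → Commute x (r i)) →
    Commute x (prodSeq r n)
  | 0, _ => Commute.one_right x
  | n + 1, h => (commute_prodSeq fun i hi => h i (by omega)).mul_right (h n (by omega))

section

variable {W : Type*} [AddCommGroup W] [Module K W] (α : B →ₗ[K] W)

lemma cyclic_symz : ∀ {n : ℕ}, (∀ i, i + 1 < n → ∀ x, α (r i * x) = α (x * r i)) →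
    ∀ x, α (symz q r n * x) = α (x * symz q r n)
  | 0, _, x => by simp [symz]
  | 1, _, x => by simp [symz]
  | n + 2, h, x => by
    have ih := cyclic_symz (n := n + 1) fun i hi => h i (by omega)
    have hn := h n (by omega)
    have hm : ∀ y, α ((q⁻¹ ^ (n + 1) • (1 : B) + qInt q (n + 1) • r n) * y) =
        α (y * (q⁻¹ ^ (n + 1) • (1 : B) + qInt q (n + 1) • r n)) := fun y => by
      simp [add_mul, mul_add, hn]
    rw [symz, smul_mul_assoc, mul_smul_comm, map_smul, map_smul]
    congr 1
    rw [mul_assoc, mul_assoc, ih, mul_assoc, hm, mul_assoc, mul_assoc, ih]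
    simp only [mul_assoc]

/-- Newton's recursion for a trace functional on the Hecke algebra. -/
theorem newton_of_cyclic (hq0 : q ≠ 0) (hd : q - q⁻¹ ≠ 0)
    (hqn : ∀ n : ℕ, 1 ≤ n → qInt q n ≠ 0) {k : ℕ} (h : HeckeSeq q r k)
    (hα : ∀ i, i + 1 < k → ∀ x, α (r i * x) = α (x * r i)) :
    ∀ n p : ℕ, p + (n + 1) = k →
      qInt q (n + 1) • α (prodSeq r p * symz q (fun i => r (p + i)) (n + 1)) =
        ∑ i ∈ Finset.range (n + 1), q⁻¹ ^ i •
          α (prodSeq r (k - i - 1) * symz q (fun j => r (k - i + j)) i)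
  | 0, p, hp => by
    obtain rfl : k = p + 1 := by omega
    simp [symz, qInt_one hd]
  | n + 1, p, hp => by
    have ih := newton_of_cyclic hq0 hd hqn h hα n (p + 1) (by omega)
    rw [Finset.sum_range_succ, ← ih,
      symz_succ_left hq0 hd hqn (HeckeSeq.shift p (h.mono (by omega))),
      mul_smul_comm, map_smul, smul_smul, mul_inv_cancel₀ (hqn _ (by omega)), one_smul]
    have e : (fun i => r (p + (1 + i))) = fun i => r (p + 1 + i) := by
      funext i; rw [add_assoc]
    have e' : k - (n + 1) = p + 1 := by omega
    simp only [e, e', Nat.add_sub_cancel, add_zero]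
    set S := symz q (fun i => r (p + 1 + i)) (n + 1)
    have hS : HeckeSeq q (fun i => r (p + 1 + i)) (n + 1) := HeckeSeq.shift _ (h.mono (by omega))
    have hSS : S * S = S := symz_mul_self hq0 hd hqn hS
    have hc : Commute S (prodSeq r p) :=
      commute_prodSeq fun i hi => (commute_symz fun j hj =>
        h.comm i _ (by omega) (by omega)).symm
    have hcyc : ∀ x, α (S * x) = α (x * S) :=
      cyclic_symz α fun i hi => hα _ (by omega)
    have hm : ∀ y, α (prodSeq r p * (S * y * S)) = α (prodSeq r p * y * S) := fun y => by
      rw [mul_assoc S, ← mul_assoc _ S, ← hc.eq, mul_assoc, hcyc]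
      simp only [mul_assoc, hSS]
    rw [hm, mul_add, add_mul, map_add, add_comm]
    simp [prodSeq]

end

end AbstractSymmetrizer

section Embeddings

variable {A : Type*} [Ring A] {N : ℕ}

open Classical in
/-- The operator on `V^{⊗m}` that acts as `X` on the tensor factors `e 0, e 1, …` and as the
identity on the others. -/
noncomputable def emb {n m : ℕ} (e : Fin n → Fin m) (X : Op N A n) : Op N A m := fun a b =>
  if ∀ j, j ∉ Set.range e → a j = b j then X (a ∘ e) (b ∘ e) else 0

lemma eq_of_comp_eq {n m : ℕ} {e : Fin n → Fin m} {a b : Fin m → Fin N}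
    (h : ∀ j, j ∉ Set.range e → a j = b j) (h' : a ∘ e = b ∘ e) : a = b := by
  funext j
  by_cases hj : j ∈ Set.range e
  · obtain ⟨i, rfl⟩ := hj
    exact congrFun h' i
  · exact h j hj

lemma emb_one {n m : ℕ} (e : Fin n → Fin m) : emb e (1 : Op N A n) = 1 := by
  ext a b
  by_cases hab : a = b
  · subst hab; simp [emb]
  · rw [Matrix.one_apply_ne hab, emb]
    split_ifs with h
    · exact Matrix.one_apply_ne fun h' => hab (eq_of_comp_eq h h')
    · rfl

lemma emb_mul {n m : ℕ} {e : Fin n → Fin m} (he : Function.Injective e) (X Y : Op N A n) :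
    emb e (X * Y) = emb e X * emb e Y := by
  classical
  ext a b
  have hoff : ∀ (d : Fin n → Fin N) j, j ∉ Set.range e → Function.extend e d a j = a j :=
    fun d j hj => Function.extend_apply' _ _ _ hj
  have hon : ∀ d : Fin n → Fin N, Function.extend e d a ∘ e = d := fun d => funext fun i => he.extend_apply d a i
  have hinj : Function.Injective fun d : Fin n → Fin N => Function.extend e d a :=
    fun d d' h => by rw [← hon d, ← hon d']; exact congrArg (· ∘ e) h
  rw [Matrix.mul_apply, ← Finset.sum_subset (Finset.subset_univ (Finset.univ.image
    fun d : Fin n → Fin N => Function.extend e d a)), Finset.sum_image hinj.injOn]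
  · by_cases h : ∀ j, j ∉ Set.range e → a j = b j
    · simp only [emb, if_pos h, Matrix.mul_apply, hon]
      refine Finset.sum_congr rfl fun d _ => ?_
      rw [if_pos fun j hj => (hoff d j hj).symm, if_pos fun j hj => by rw [hoff d j hj, h j hj]]
    · rw [emb, if_neg h]
      refine (Finset.sum_eq_zero fun d _ => ?_).symm
      simp only [emb]
      rw [if_neg (c := ∀ j, j ∉ Set.range e → Function.extend e d a j = b j), mul_zero]
      exact fun h' => h fun j hj => by rw [← h' j hj, hoff d j hj]
  · intro c _ hc
    simp only [emb]
    rw [if_neg, zero_mul]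
    intro h
    refine hc (Finset.mem_image.mpr ⟨c ∘ e, Finset.mem_univ _, ?_⟩)
    exact eq_of_comp_eq (e := e) (fun j hj => by rw [hoff _ j hj, h j hj]) (hon _)

lemma emb_commute {n n' m : ℕ} {e : Fin n → Fin m} {e' : Fin n' → Fin m}
    (hd : Disjoint (Set.range e) (Set.range e')) {X : Op N A n} {Y : Op N A n'}
    (hXY : ∀ a b c d, Commute (X a b) (Y c d)) : Commute (emb e X) (emb e' Y) := by
  classical
  have key : ∀ {n n' : ℕ} {e : Fin n → Fin m} {e' : Fin n' → Fin m}
      (_ : Disjoint (Set.range e) (Set.range e')) (X : Op N A n) (Y : Op N A n')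
      (a b : Fin m → Fin N), (emb e X * emb e' Y) a b =
        if ∀ j, j ∉ Set.range e → j ∉ Set.range e' → a j = b j then
          X (a ∘ e) (b ∘ e) * Y (a ∘ e') (b ∘ e') else 0 := by
    intro n n' e e' hd X Y a b
    set c : Fin m → Fin N := fun j => if j ∈ Set.range e then b j else a j with hc
    have c1 : ∀ j, j ∈ Set.range e → c j = b j := fun j hj => if_pos hj
    have c2 : ∀ j, j ∉ Set.range e → c j = a j := fun j hj => if_neg hj
    have c3 : ∀ j, j ∈ Set.range e' → j ∉ Set.range e := fun j hj hj' =>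
      Set.disjoint_left.mp hd hj' hj
    rw [Matrix.mul_apply, Finset.sum_eq_single c]
    · have e1 : c ∘ e = b ∘ e := funext fun i => c1 _ ⟨i, rfl⟩
      have e2 : c ∘ e' = a ∘ e' := funext fun i => c2 _ (c3 _ ⟨i, rfl⟩)
      simp only [emb]
      rw [if_pos fun j hj => (c2 j hj).symm, e1, e2]
      by_cases h : ∀ j, j ∉ Set.range e → j ∉ Set.range e' → a j = b j
      · rw [if_pos h, if_pos]
        intro j hj
        by_cases hj' : j ∈ Set.range e
        · exact c1 j hj'
        · rw [c2 j hj', h j hj' hj]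
      · rw [if_neg h, if_neg, mul_zero]
        exact fun h' => h fun j hj hj' => by rw [← h' j hj', c2 j hj]
    · intro d _ hd'
      simp only [emb]
      by_cases h1 : ∀ j, j ∉ Set.range e → a j = d j
      · rw [if_neg (c := ∀ j, j ∉ Set.range e' → d j = b j), mul_zero]
        refine fun h2 => hd' (funext fun j => ?_)
        by_cases hj : j ∈ Set.range e
        · rw [c1 j hj, h2 j fun hj' => c3 j hj' hj]
        · rw [c2 j hj, h1 j hj]
      · rw [if_neg h1, zero_mul]
    · simp
  ext a b
  rw [key hd, key hd.symm]
  refine ite_congr (propext ⟨fun h j h1 h2 => h j h2 h1, fun h j h1 h2 => h j h2 h1⟩)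
    (fun _ => hXY _ _ _ _) fun _ => rfl

lemma site_map {B : Type*} [Ring B] (f : A →+* B) (m i : ℕ) (X : M2 N A) :
    site m i (X.map f) = (site m i X).map f := by
  ext a b
  simp only [site, Matrix.map_apply]
  split_ifs <;> simp

lemma emb_site {n m j i : ℕ} {e : Fin n → Fin m} (he : Function.Injective e) (hj : j + 1 < n)
    (h1 : (e ⟨j, by omega⟩ : ℕ) = i) (h2 : (e ⟨j + 1, hj⟩ : ℕ) = i + 1) (X : M2 N A) :
    emb e (site n j X) = site m i X := by
  have hi : i + 1 < m := h2 ▸ (e ⟨j + 1, hj⟩).2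
  have e1 : e ⟨j, by omega⟩ = ⟨i, by omega⟩ := Fin.ext h1
  have e2 : e ⟨j + 1, hj⟩ = ⟨i + 1, hi⟩ := Fin.ext h2
  ext a b
  simp only [emb, site, dif_pos hj, dif_pos hi, Function.comp, e1, e2]
  by_cases h : ∀ l : Fin m, (l : ℕ) ≠ i → (l : ℕ) ≠ i + 1 → a l = b l
  · rw [if_pos h, if_pos, if_pos]
    · intro l hl hl'
      exact h _ (fun h' => hl (congrArg Fin.val (he (Fin.ext (h'.trans h1.symm)))))
        fun h' => hl' (congrArg Fin.val (he (Fin.ext (h'.trans h2.symm))))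
    · intro l hl
      exact h _ (fun h' => hl ⟨_, Fin.ext (h1.trans h'.symm)⟩)
        fun h' => hl ⟨_, Fin.ext (h2.trans h'.symm)⟩
  · rw [if_neg h]
    split_ifs with h3 h4
    · refine absurd (fun l hl hl' => ?_) h
      by_cases hl'' : l ∈ Set.range e
      · obtain ⟨s, rfl⟩ := hl''
        refine h4 s (fun hs => hl ?_) fun hs => hl' ?_
        · rw [← h1]; exact congrArg (fun t => (e t : ℕ)) (Fin.ext hs)
        · rw [← h2]; exact congrArg (fun t => (e t : ℕ)) (Fin.ext hs)
      · exact h3 l hl''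
    · rfl
    · simp

lemma emb_site1 {n m j i : ℕ} {e : Fin n → Fin m} (he : Function.Injective e) (hj : j < n)
    (h1 : (e ⟨j, hj⟩ : ℕ) = i) (X : Matrix (Fin N) (Fin N) A) :
    emb e (site1 n j X) = site1 m i X := by
  have hi : i < m := h1 ▸ (e ⟨j, hj⟩).2
  have e1 : e ⟨j, hj⟩ = ⟨i, hi⟩ := Fin.ext h1
  ext a b
  simp only [emb, site1, dif_pos hj, dif_pos hi, Function.comp, e1]
  by_cases h : ∀ l : Fin m, (l : ℕ) ≠ i → a l = b l
  · rw [if_pos h, if_pos, if_pos]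
    · intro l hl
      exact h _ fun h' => hl (congrArg Fin.val (he (Fin.ext (h'.trans h1.symm))))
    · intro l hl
      exact h _ fun h' => hl ⟨_, Fin.ext (h1.trans h'.symm)⟩
  · rw [if_neg h]
    split_ifs with h3 h4
    · refine absurd (fun l hl => ?_) h
      by_cases hl'' : l ∈ Set.range e
      · obtain ⟨s, rfl⟩ := hl''
        refine h4 s fun hs => hl ?_
        rw [← h1]; exact congrArg (fun t => (e t : ℕ)) (Fin.ext hs)
      · exact h3 l hl''
    · rfl
    · simp

/-- The inclusion of `n` consecutive tensor factors starting at `i`. -/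
def consec {n m : ℕ} (i : ℕ) (h : i + n ≤ m) (j : Fin n) : Fin m := ⟨i + j, by omega⟩

lemma consec_injective {n m i : ℕ} (h : i + n ≤ m) : Function.Injective (consec i h) :=
  fun a b hab => Fin.ext (by simpa [consec] using hab)

lemma emb_consec_site {n m i : ℕ} (h : i + n ≤ m) {j : ℕ} (hj : j + 1 < n) (X : M2 N A) :
    emb (consec i h) (site n j X) = site m (i + j) X :=
  emb_site (consec_injective h) hj rfl rfl X

lemma site_two (X : M2 N A) :
    site 2 0 X = X.submatrix (finTwoArrowEquiv (Fin N)) (finTwoArrowEquiv (Fin N)) := by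
  ext a b
  simp [site, finTwoArrowEquiv]

lemma site_mul {m i : ℕ} (hi : i + 1 < m) (X Y : M2 N A) :
    site m i (X * Y) = site m i X * site m i Y := by
  have h : i + 2 ≤ m := hi
  have e := fun X : M2 N A => emb_consec_site h (j := 0) (by omega) X
  simp only [add_zero] at e
  rw [← e, ← e, ← e, ← emb_mul (consec_injective h), site_two, site_two, site_two,
    Matrix.submatrix_mul_equiv]

lemma site_one {m i : ℕ} (hi : i + 1 < m) : site m i (1 : M2 N A) = 1 := by
  have h : i + 2 ≤ m := hi
  rw [← add_zero i, ← emb_consec_site h (by omega), site_two, Matrix.submatrix_one_equiv, emb_one]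

lemma site_add {m i : ℕ} (hi : i + 1 < m) (X Y : M2 N A) :
    site m i (X + Y) = site m i X + site m i Y := by
  ext a b
  simp only [site, hi, dif_pos, Matrix.add_apply, add_mul]

lemma site_smul {K : Type*} [Field K] [Algebra K A] {m i : ℕ} (hi : i + 1 < m) (c : K)
    (X : M2 N A) : site m i (c • X) = c • site m i X := by
  ext a b
  simp [site, hi]

lemma site_commute {m i j : ℕ} (hij : i + 1 < j) (hj : j + 1 < m) {X Y : M2 N A}
    (hXY : ∀ a b c d, Commute (X a b) (Y c d)) : Commute (site m i X) (site m j Y) := by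
  have hi' : i + 2 ≤ m := by omega
  have hj' : j + 2 ≤ m := hj
  rw [← add_zero i, ← add_zero j, ← emb_consec_site hi' (by omega) X,
    ← emb_consec_site hj' (by omega) Y]
  refine emb_commute ?_ ?_
  · rw [Set.disjoint_left]
    rintro _ ⟨a, rfl⟩ ⟨b, hb⟩
    have := congrArg Fin.val hb
    simp only [consec] at this
    omega
  · intro a b c d
    simp only [site_two, Matrix.submatrix_apply]
    exact hXY _ _ _ _

lemma site1_commute {m i j : ℕ} (hij : j < i) (hi : i + 1 < m) {X : M2 N A}
    {M : Matrix (Fin N) (Fin N) A} (hXY : ∀ a b c d, Commute (X a b) (M c d)) :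
    Commute (site m i X) (site1 m j M) := by
  have hi' : i + 2 ≤ m := hi
  have hj' : j + 1 ≤ m := by omega
  have e : emb (consec j hj') (site1 1 0 M) = site1 m j M :=
    emb_site1 (consec_injective hj') (by omega) rfl M
  rw [← e, ← add_zero i, ← emb_consec_site hi' (by omega) X]
  refine emb_commute ?_ ?_
  · rw [Set.disjoint_left]
    rintro _ ⟨a, rfl⟩ ⟨b, hb⟩
    have := congrArg Fin.val hb
    simp only [consec] at this
    omega
  · intro a b c d
    simp only [site_two, Matrix.submatrix_apply, site1, dif_pos Nat.one_pos]
    split_ifs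
    · rw [mul_one]; exact hXY _ _ _ _
    · rw [mul_zero]; exact Commute.zero_right _

lemma site_rel_of_site_three {m i : ℕ} (hi : i + 2 < m) {X Y Z X' Y' Z' : M2 N A}
    {a b c a' b' c' : Fin 2}
    (h : site 3 a X * site 3 b Y * site 3 c Z = site 3 a' X' * site 3 b' Y' * site 3 c' Z') :
    site m (i + a) X * site m (i + b) Y * site m (i + c) Z =
      site m (i + a') X' * site m (i + b') Y' * site m (i + c') Z' := by
  have hi' : i + 3 ≤ m := hi
  have e := fun (j : Fin 2) (X : M2 N A) => emb_consec_site hi' (j := j) (by omega) X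
  simp only [← e, ← emb_mul (consec_injective hi'), h]

end Embeddings

section Copies

variable {A : Type*} [Ring A] {N : ℕ}

/-- A two-site operator with central entries. -/
def CentralEntries (X : M2 N A) : Prop := ∀ a b c, Commute (X a b) c

/-- The compatibility relations of `X` with the braiding `F`. -/
structure Twist (F X : M2 N A) : Prop where
  left : site 3 0 X * site 3 1 F * site 3 0 F = site 3 1 F * site 3 0 F * site 3 1 X
  right : site 3 0 F * site 3 1 F * site 3 0 X = site 3 1 X * site 3 0 F * site 3 1 F

lemma twist_self {F : M2 N A} (h : YB F) : Twist F F := ⟨h, h⟩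

lemma Twist.mul {F X Y : M2 N A} (hX : Twist F X) (hY : Twist F Y) : Twist F (X * Y) := by
  have h0 : 0 + 1 < 3 := by omega
  have h1 : 1 + 1 < 3 := by omega
  constructor
  · have e := congrArg (site 3 0 X * ·) hY.left
    simp only [← mul_assoc, hX.left] at e
    simpa only [site_mul h0, site_mul h1, ← mul_assoc] using e
  · have e := congrArg (site 3 1 X * ·) hY.right
    simp only [← mul_assoc, ← hX.right] at e
    simpa only [site_mul h0, site_mul h1, ← mul_assoc] using e

lemma site_mul_inv {X Y : M2 N A} (h : X * Y = 1) {m i : ℕ} (hi : i + 1 < m) :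
    site m i X * site m i Y = 1 := by rw [← site_mul hi, h, site_one hi]

lemma Twist.inv {F X Y : M2 N A} (hX : Twist F X) (h : X * Y = 1) (h' : Y * X = 1) :
    Twist F Y := by
  have a0 := site_mul_inv h' (m := 3) (i := 0) (by omega)
  have a1 := site_mul_inv h (m := 3) (i := 1) (by omega)
  have b0 := site_mul_inv h (m := 3) (i := 0) (by omega)
  have b1 := site_mul_inv h' (m := 3) (i := 1) (by omega)
  constructor
  · calc site 3 0 Y * site 3 1 F * site 3 0 F
        = site 3 0 Y * (site 3 1 F * site 3 0 F * site 3 1 X) * site 3 1 Y := by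
          simp only [mul_assoc, a1, mul_one]
      _ = (site 3 0 Y * site 3 0 X) * site 3 1 F * site 3 0 F * site 3 1 Y := by
          rw [← hX.left]; simp only [mul_assoc]
      _ = _ := by rw [a0, one_mul]
  · calc site 3 0 F * site 3 1 F * site 3 0 Y
        = site 3 1 Y * (site 3 1 X * site 3 0 F * site 3 1 F) * site 3 0 Y := by
          simp only [← mul_assoc, b1, one_mul]
      _ = site 3 1 Y * site 3 0 F * site 3 1 F * (site 3 0 X * site 3 0 Y) := by
          rw [← hX.right]; simp only [mul_assoc]
      _ = _ := by rw [b0, mul_one]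

lemma Twist.map {B : Type*} [Ring B] (f : A →+* B) {F X : M2 N A} (h : Twist F X) :
    Twist (F.map f) (X.map f) := by
  constructor <;> simp only [site_map, ← Matrix.map_mul]
  · rw [h.left]
  · rw [h.right]

lemma Twist.site_left {F X : M2 N A} (h : Twist F X) {m i : ℕ} (hi : i + 2 < m) :
    site m i X * site m (i + 1) F * site m i F =
      site m (i + 1) F * site m i F * site m (i + 1) X :=
  site_rel_of_site_three hi (a := 0) (b := 1) (c := 0) (a' := 1) (b' := 0) (c' := 1) h.left

lemma Twist.site_right {F X : M2 N A} (h : Twist F X) {m i : ℕ} (hi : i + 2 < m) :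
    site m i F * site m (i + 1) F * site m i X =
      site m (i + 1) X * site m i F * site m (i + 1) F :=
  site_rel_of_site_three hi (a := 0) (b := 1) (c := 0) (a' := 1) (b' := 0) (c' := 1) h.right

/-- A braiding with central entries, together with its inverse. -/
structure BraidPair (F F' : M2 N A) : Prop where
  mul_inv : F * F' = 1
  inv_mul : F' * F = 1
  central : CentralEntries F
  twist : Twist F F

variable {F F' : M2 N A} {M : Matrix (Fin N) (Fin N) A} {m : ℕ}

lemma semiconj_Mbar (hF : BraidPair F F') {i : ℕ} (hi : i + 1 < m) :
    SemiconjBy (site m i F) (Mbar m F F' M i) (Mbar m F F' M (i + 1)) := by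
  rw [SemiconjBy, Mbar, mul_assoc, site_mul_inv hF.inv_mul hi, mul_one]

lemma commute_Mbar_of_lt {X : M2 N A} (hX : CentralEntries X) {i j : ℕ} (hji : j < i)
    (hi : i + 1 < m) : Commute (site m i X) (Mbar m F F' M j) := by
  induction j with
  | zero => exact site1_commute hji hi fun a b c d => hX _ _ _
  | succ j ih =>
    have h1 : ∀ Y : M2 N A, Commute (site m i X) (site m j Y) := fun Y =>
      (site_commute hji hi fun a b c d => (hX _ _ _).symm).symm
    exact ((h1 _).mul_right (ih (by omega))).mul_right (h1 _)

lemma commute_of_conj {B : Type*} [Ring B] {V V' x y a c : B} (hV : V * V' = 1)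
    (hac : SemiconjBy V a c) (hxy : x * V = V * y) (hya : Commute y a) : Commute x c :=
  calc x * c = x * (c * V) * V' := by rw [mul_assoc, mul_assoc c, hV, mul_one]
    _ = x * V * a * V' := by rw [← hac.eq]; simp only [mul_assoc]
    _ = V * (y * a) * V' := by rw [hxy]; simp only [mul_assoc]
    _ = (V * a) * y * V' := by rw [hya.eq]; simp only [mul_assoc]
    _ = c * (V * y) * V' := by rw [hac.eq]; simp only [mul_assoc]
    _ = c * x * (V * V') := by rw [← hxy]; simp only [mul_assoc]
    _ = c * x := by rw [hV, mul_one]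

lemma commute_Mbar_of_gt (hF : BraidPair F F') {X : M2 N A} (hX : CentralEntries X)
    (hXF : Twist F X) {i j : ℕ} (hij : i + 1 < j) (hj : j < m) :
    Commute (site m i X) (Mbar m F F' M j) := by
  induction j, hij using Nat.le_induction with
  | base =>
    have hV : SemiconjBy (site m (i + 1) F * site m i F) (Mbar m F F' M i)
        (Mbar m F F' M (i + 2)) :=
      (semiconj_Mbar hF (by omega)).mul_left (semiconj_Mbar hF (by omega))
    have hc := commute_Mbar_of_lt (F := F) (F' := F') (M := M) hX (Nat.lt_succ_self i)
      (by omega : i + 1 + 1 < m)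
    have hXV := hXF.site_left hj
    exact commute_of_conj (V' := site m i F' * site m (i + 1) F')
      (by rw [mul_assoc, ← mul_assoc (site m i F), site_mul_inv hF.mul_inv (by omega), one_mul,
        site_mul_inv hF.mul_inv (by omega)]) hV (by rw [← mul_assoc, hXV]) hc
  | succ j hij ih =>
    have h1 : ∀ Y : M2 N A, Commute (site m i X) (site m j Y) := fun Y =>
      site_commute (by omega) hj fun a b c d => hX _ _ _
    exact ((h1 _).mul_right (ih (by omega))).mul_right (h1 _)

lemma Mbar_exchange_step {B : Type*} [Ring B] {f f' g g' a b c r r₁ s s₁ : B}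
    (hf : f * f' = 1) (hg : g * g' = 1) (hfg : f * g * f = g * f * g) (hga : Commute g a)
    (hab : SemiconjBy f a b) (hbc : SemiconjBy g b c) (hr : f * g * r = r₁ * f * g)
    (hs : f * g * s = s₁ * f * g) (h : r * (a * b) = a * b * s) :
    r₁ * (b * c) = b * c * s₁ := by
  have h1 : f * g * a = b * (f * g) := hab.mul_left hga
  have h2 : f * g * b = c * (f * g) := by
    calc f * g * b = f * g * (b * f) * f' := by simp only [mul_assoc, hf, mul_one]
      _ = (f * g * f) * a * f' := by rw [← hab.eq]; simp only [mul_assoc]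
      _ = g * f * (g * a) * f' := by rw [hfg]; simp only [mul_assoc]
      _ = g * (f * a) * g * f' := by rw [hga.eq]; simp only [mul_assoc]
      _ = (g * b) * f * g * f' := by rw [hab.eq]; simp only [mul_assoc]
      _ = c * (g * f * g) * f' := by rw [hbc.eq]; simp only [mul_assoc]
      _ = c * (f * g) := by rw [← hfg]; simp only [mul_assoc, hf, mul_one]
  have h3 : b * c * (f * g) = f * g * (a * b) := by
    rw [mul_assoc, ← h2, ← mul_assoc, ← h1, mul_assoc]
  have hU : f * g * (g' * f') = 1 := by
    rw [mul_assoc, ← mul_assoc g, hg, one_mul, hf]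
  calc r₁ * (b * c) = r₁ * (b * c * (f * g)) * (g' * f') := by
        rw [mul_assoc r₁, mul_assoc (b * c), hU, mul_one]
    _ = (r₁ * f * g) * (a * b) * (g' * f') := by rw [h3]; simp only [mul_assoc]
    _ = f * g * (r * (a * b)) * (g' * f') := by rw [← hr]; simp only [mul_assoc]
    _ = (f * g * (a * b)) * s * (g' * f') := by rw [h]; simp only [mul_assoc]
    _ = b * c * (f * g * s) * (g' * f') := by rw [← h3]; simp only [mul_assoc]
    _ = b * c * s₁ * (f * g * (g' * f')) := by rw [hs]; simp only [mul_assoc]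
    _ = _ := by rw [hU, mul_one]

/-- The defining relation of `M(R̂,F̂)` for neighbouring copies of `M`. -/
lemma Mbar_exchange (hF : BraidPair F F') {R G : M2 N A} (hR : Twist F R) (hG : Twist F G)
    (h : site 2 0 R * MbarSeg 2 F F' M 0 2 = MbarSeg 2 F F' M 0 2 * site 2 0 G) {i : ℕ}
    (hi : i + 1 < m) :
    site m i R * (Mbar m F F' M i * Mbar m F F' M (i + 1)) =
      Mbar m F F' M i * Mbar m F F' M (i + 1) * site m i G := by
  induction i with
  | zero =>
    have hm : 0 + 2 ≤ m := hi
    have hinj := consec_injective hm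
    have e := fun X : M2 N A => emb_consec_site hm (j := 0) (by omega) X
    have e1 : emb (consec 0 hm) (site1 2 0 M) = site1 m 0 M := emb_site1 hinj (by omega) rfl M
    have := congrArg (emb (consec 0 hm)) h
    simpa only [MbarSeg, Mbar, one_mul, emb_mul hinj, e, e1, add_zero, zero_add] using this
  | succ i ih =>
    exact Mbar_exchange_step (site_mul_inv hF.mul_inv (by omega)) (site_mul_inv hF.mul_inv hi)
      (hF.twist.site_left hi) (commute_Mbar_of_lt hF.central (Nat.lt_succ_self i) hi)
      (semiconj_Mbar hF (by omega)) (semiconj_Mbar hF hi) (hR.site_right hi) (hG.site_right hi)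
      (ih (by omega))

lemma semiconj_MbarSeg {U : Op N A m} {p p' : ℕ} : ∀ {n : ℕ},
    (∀ j < n, SemiconjBy U (Mbar m F F' M (p + j)) (Mbar m F F' M (p' + j))) →
      SemiconjBy U (MbarSeg m F F' M p n) (MbarSeg m F F' M p' n)
  | 0, _ => SemiconjBy.one_right U
  | n + 1, h => (semiconj_MbarSeg fun j hj => h j (by omega)).mul_right (h n (by omega))

lemma MbarSeg_add (p l : ℕ) : ∀ n, MbarSeg m F F' M p (l + n) =
    MbarSeg m F F' M p l * MbarSeg m F F' M (p + l) n
  | 0 => (mul_one _).symm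
  | n + 1 => by
    rw [← add_assoc, MbarSeg, MbarSeg_add p l n, MbarSeg, mul_assoc, add_assoc]

/-- The exchange relation with the full product `M_{1̄} ⋯ M_{m̄}`. -/
lemma MbarSeg_exchange (hF : BraidPair F F') {R G : M2 N A} (hR : Twist F R) (hG : Twist F G)
    (hRc : CentralEntries R) (hGc : CentralEntries G)
    (h : site 2 0 R * MbarSeg 2 F F' M 0 2 = MbarSeg 2 F F' M 0 2 * site 2 0 G) {i : ℕ}
    (hi : i + 1 < m) :
    site m i R * MbarSeg m F F' M 0 m = MbarSeg m F F' M 0 m * site m i G := by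
  obtain ⟨l, rfl⟩ : ∃ l, m = i + 2 + l := ⟨m - (i + 2), by omega⟩
  have h1 : Commute (site (i + 2 + l) i R) (MbarSeg (i + 2 + l) F F' M 0 i) :=
    semiconj_MbarSeg fun j hj => commute_Mbar_of_lt hRc (by omega) hi
  have h2 : Commute (site (i + 2 + l) i G) (MbarSeg (i + 2 + l) F F' M (i + 2) l) :=
    semiconj_MbarSeg fun j hj => commute_Mbar_of_gt hF hGc hG (by omega) (by omega)
  have h3 := Mbar_exchange (M := M) hF hR hG h hi
  rw [MbarSeg_add, zero_add, MbarSeg, MbarSeg, zero_add, zero_add]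
  generalize MbarSeg (i + 2 + l) F F' M 0 i = P at *
  generalize MbarSeg (i + 2 + l) F F' M (i + 2) l = Q at *
  calc _ = site (i + 2 + l) i R * P * (Mbar (i + 2 + l) F F' M i * Mbar (i + 2 + l) F F' M (i + 1))
        * Q := by simp only [mul_assoc]
    _ = P * (Mbar (i + 2 + l) F F' M i * Mbar (i + 2 + l) F F' M (i + 1)) *
        (site (i + 2 + l) i G * Q) := by
      rw [h1.eq, mul_assoc P, h3]; simp only [mul_assoc]
    _ = _ := by rw [h2.eq]; simp only [mul_assoc]

lemma semiconj_symz {K B : Type*} [Field K] [Ring B] [Algebra K B] {q : K} {r r' : ℕ → B} {U : B} :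
    ∀ {n : ℕ}, (∀ i, i + 1 < n → SemiconjBy U (r i) (r' i)) →
      SemiconjBy U (symz q r n) (symz q r' n)
  | 0, _ => SemiconjBy.one_right U
  | 1, _ => SemiconjBy.one_right U
  | n + 2, h => by
    have ih : SemiconjBy U (symz q r (n + 1)) (symz q r' (n + 1)) :=
      semiconj_symz fun i hi => h i (by omega)
    have hs : ∀ (c : K) {x y : B}, SemiconjBy U x y → SemiconjBy U (c • x) (c • y) :=
      fun c x y hxy => by rw [SemiconjBy, mul_smul_comm, hxy.eq, smul_mul_assoc]
    exact hs _ ((ih.mul_right ((hs _ (SemiconjBy.one_right U)).add_right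
      (hs _ (h n (by omega))))).mul_right ih)

lemma commute_chain {p n : ℕ} {Y : Op N A m} {X : M2 N A}
    (h : ∀ i < n, Commute (site m (p + i) X) Y) : Commute (chain m X p n) Y := by
  induction n with
  | zero => exact Commute.one_left Y
  | succ n ih => exact (ih fun i hi => h i (by omega)).mul_left (h n (by omega))

lemma semiconj_chain_Mbar (hF : BraidPair F F') {p n j : ℕ} (hj : j < n) (hn : p + n < m) :
    SemiconjBy (chain m F p n) (Mbar m F F' M (p + j)) (Mbar m F F' M (p + 1 + j)) := by
  induction n with
  | zero => omega
  | succ n ih =>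
    rw [chain]
    rcases Nat.lt_succ_iff_lt_or_eq.mp hj with hlt | rfl
    · exact (ih hlt (by omega)).mul_left (commute_Mbar_of_lt hF.central (by omega) (by omega))
    · refine SemiconjBy.mul_left (commute_chain (n := j) fun i hi => ?_)
        ((add_right_comm p j 1) ▸ semiconj_Mbar hF (by omega))
      exact commute_Mbar_of_gt hF hF.central hF.twist (by omega) (by omega)

lemma semiconj_chain_site (hF : BraidPair F F') {R : M2 N A} (hR : Twist F R) {p n j : ℕ}
    (hj : j + 1 < n) (hn : p + n < m) :
    SemiconjBy (chain m F p n) (site m (p + j) R) (site m (p + 1 + j) R) := by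
  induction n with
  | zero => omega
  | succ n ih =>
    rw [chain]
    rcases Nat.lt_succ_iff_lt_or_eq.mp hj with hlt | rfl
    · refine (ih hlt (by omega)).mul_left (Commute.symm ?_)
      exact site_commute (by omega) (by omega) fun a b c d => (hF.central _ _ _).symm
    · rw [chain, mul_assoc, add_right_comm p 1 j]
      refine SemiconjBy.mul_left (commute_chain fun i hi => ?_) ?_
      · exact site_commute (by omega) (by omega) fun a b c d => hF.central _ _ _
      · rw [SemiconjBy, ← mul_assoc]
        exact hR.site_right (by omega)

end Copies

section PartialTrace

variable {K : Type*} [Field K] {A : Type*} [Ring A] [Algebra K A] {N : ℕ}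

/-- Adds one tensor factor on the right, acting on it as the identity. -/
noncomputable def lift {m : ℕ} (X : Op N A m) : Op N A (m + 1) := emb Fin.castSucc X

lemma lift_mul {m : ℕ} (X Y : Op N A m) : lift (X * Y) = lift X * lift Y :=
  emb_mul (Fin.castSucc_injective m) X Y

lemma lift_one {m : ℕ} : lift (1 : Op N A m) = 1 := emb_one _

lemma lift_apply_snoc {m : ℕ} (X : Op N A m) (a b : Fin m → Fin N) (c d : Fin N) :
    lift X (Fin.snoc a c) (Fin.snoc b d) = if c = d then X a b else 0 := by
  have h1 : ∀ (a : Fin m → Fin N) c, (Fin.snoc a c : Fin (m + 1) → Fin N) ∘ Fin.castSucc = a :=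
    fun a c => funext fun i => Fin.snoc_castSucc (α := fun _ => Fin N) c a i
  rw [lift, emb, h1, h1]
  refine if_congr ⟨fun h => ?_, ?_⟩ rfl rfl
  · simpa using h (Fin.last m) (by simp)
  · rintro rfl j hj
    obtain rfl : j = Fin.last m := by
      by_contra hne
      exact hj ⟨j.castPred hne, by simp⟩
    simp

lemma lift_site {m i : ℕ} (hi : i + 1 < m) (X : M2 N A) :
    lift (site m i X) = site (m + 1) i X :=
  emb_site (Fin.castSucc_injective m) hi rfl rfl X

lemma lift_Mbar {F F' : M2 N A} {M : Matrix (Fin N) (Fin N) A} {m k : ℕ} (hk : k < m) :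
    lift (Mbar m F F' M k) = Mbar (m + 1) F F' M k := by
  induction k with
  | zero => exact emb_site1 (Fin.castSucc_injective m) hk rfl M
  | succ k ih => rw [Mbar, Mbar, lift_mul, lift_mul, lift_site hk, lift_site hk, ih (by omega)]

lemma lift_MbarSeg {F F' : M2 N A} {M : Matrix (Fin N) (Fin N) A} {m p : ℕ} :
    ∀ {n : ℕ}, p + n ≤ m → lift (MbarSeg m F F' M p n) = MbarSeg (m + 1) F F' M p n
  | 0, _ => lift_one
  | n + 1, h => by rw [MbarSeg, MbarSeg, lift_mul, lift_MbarSeg (by omega), lift_Mbar (by omega)]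

lemma lift_chain {X : M2 N A} {m p : ℕ} :
    ∀ {n : ℕ}, p + n < m → lift (chain m X p n) = chain (m + 1) X p n
  | 0, _ => lift_one
  | n + 1, h => by rw [chain, chain, lift_mul, lift_chain (by omega), lift_site (by omega)]

lemma lift_diagonal {m : ℕ} (t : A) :
    lift (Matrix.diagonal fun _ => t : Op N A m) = Matrix.diagonal fun _ => t := by
  ext a b
  rw [← Fin.snoc_init_self a, ← Fin.snoc_init_self b, lift_apply_snoc]
  by_cases h : a = b
  · subst h; simp
  · rw [Fin.snoc_init_self, Fin.snoc_init_self, Matrix.diagonal_apply_ne _ h]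
    split_ifs with h1
    · refine Matrix.diagonal_apply_ne _ fun h2 => h ?_
      rw [← Fin.snoc_init_self a, ← Fin.snoc_init_self b, h1, h2]
    · rfl

lemma sum_snoc {V : Type*} [AddCommMonoid V] {m : ℕ} (f : (Fin (m + 1) → Fin N) → V) :
    ∑ d, f d = ∑ d : Fin m → Fin N, ∑ c : Fin N, f (Fin.snoc d c) := by
  rw [← (Fin.snocEquiv fun _ : Fin (m + 1) => Fin N).sum_comp, Fintype.sum_prod_type_right]
  rfl

lemma site_last {m : ℕ} (X : M2 N A) (a b : Fin m → Fin N) (x y c e : Fin N) :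
    site (m + 2) m X (Fin.snoc (Fin.snoc a x : Fin (m + 1) → Fin N) e)
      (Fin.snoc (Fin.snoc b y : Fin (m + 1) → Fin N) c) =
      if a = b then X (x, e) (y, c) else 0 := by
  have h0 : ∀ (a : Fin m → Fin N) (x e : Fin N),
      (Fin.snoc (Fin.snoc a x : Fin (m + 1) → Fin N) e : Fin (m + 2) → Fin N)
        ⟨m, by omega⟩ = x := fun a x e => by
    rw [show (⟨m, by omega⟩ : Fin (m + 2)) = (Fin.last m).castSucc from rfl,
      Fin.snoc_castSucc (α := fun _ => Fin N), Fin.snoc_last]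
  have h1 : ∀ (a : Fin m → Fin N) (x e : Fin N),
      (Fin.snoc (Fin.snoc a x : Fin (m + 1) → Fin N) e : Fin (m + 2) → Fin N)
        ⟨m + 1, by omega⟩ = e := fun a x e => by
    rw [show (⟨m + 1, by omega⟩ : Fin (m + 2)) = Fin.last (m + 1) from rfl, Fin.snoc_last]
  have h2 : ∀ (a : Fin m → Fin N) (x e : Fin N) (j : Fin m),
      (Fin.snoc (Fin.snoc a x : Fin (m + 1) → Fin N) e : Fin (m + 2) → Fin N)
        j.castSucc.castSucc = a j := fun a x e j => by
    rw [Fin.snoc_castSucc (α := fun _ => Fin N), Fin.snoc_castSucc (α := fun _ => Fin N)]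
  rw [site, dif_pos (by omega), h0, h0, h1, h1, mul_ite, mul_one, mul_zero]
  refine if_congr ⟨fun h => funext fun j => ?_, ?_⟩ rfl rfl
  · have := h j.castSucc.castSucc j.2.ne (by simp; omega)
    rwa [h2, h2] at this
  · rintro rfl j hj hj'
    have := h2 a x e ⟨j, by omega⟩
    exact this.trans (h2 a y c ⟨j, by omega⟩).symm

variable (D : Matrix (Fin N) (Fin N) K)

lemma qtr1_lift_mul {m : ℕ} (X : Op N A m) (Z : Op N A (m + 1)) :
    qtr1 D (lift X * Z) = X * qtr1 D Z := by
  ext a b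
  simp only [qtr1, Matrix.mul_apply, sum_snoc, lift_apply_snoc, ite_mul, zero_mul,
    Finset.sum_ite_eq, Finset.mem_univ, if_true, Finset.mul_sum]
  rw [Finset.sum_comm_cycle]
  refine Finset.sum_congr rfl fun d _ => Finset.sum_congr rfl fun c _ =>
    Finset.sum_congr rfl fun e _ => ?_
  rw [← mul_assoc, ← mul_assoc, Algebra.commutes]

lemma qtr1_mul_lift {m : ℕ} (X : Op N A m) (Z : Op N A (m + 1)) :
    qtr1 D (Z * lift X) = qtr1 D Z * X := by
  ext a b
  simp only [qtr1, Matrix.mul_apply, sum_snoc, lift_apply_snoc, mul_ite, mul_zero,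
    Finset.sum_ite_eq', Finset.mem_univ, if_true, Finset.mul_sum, Finset.sum_mul]
  rw [Finset.sum_comm_cycle]
  simp only [mul_assoc]

lemma qtrAll_qtr1 {m : ℕ} (Z : Op N A (m + 1)) : qtrAll D (qtr1 D Z) = qtrAll D Z := by
  simp only [qtrAll, qtr1, sum_snoc, Fin.prod_univ_castSucc, Fin.snoc_castSucc, Fin.snoc_last,
    Finset.mul_sum, map_mul, mul_assoc]
  exact Finset.sum_congr rfl fun a _ => Finset.sum_comm

lemma qtrAll_qtrs {p : ℕ} : ∀ {n : ℕ} (Z : Op N A (p + n)),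
    qtrAll D (qtrs D p n Z) = qtrAll D Z
  | 0, _ => rfl
  | n + 1, Z => by rw [qtrs, qtrAll_qtrs, qtrAll_qtr1]

lemma qtrAll_mul_diagonal {m : ℕ} (X : Op N A m) (t : A) :
    qtrAll D (X * Matrix.diagonal fun _ => t) = qtrAll D X * t := by
  simp only [qtrAll, Matrix.mul_diagonal, Finset.sum_mul, mul_assoc]

/-- Adds `n` tensor factors on the right, acting on them as the identity. -/
noncomputable def liftn {m : ℕ} (X : Op N A m) : (n : ℕ) → Op N A (m + n)
  | 0 => X
  | n + 1 => lift (liftn X n)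

lemma qtrs_liftn_mul {m : ℕ} (X : Op N A m) : ∀ {n : ℕ} (Z : Op N A (m + n)),
    qtrs D m n (liftn X n * Z) = X * qtrs D m n Z
  | 0, _ => rfl
  | n + 1, Z => by
    rw [qtrs, qtrs, ← qtrs_liftn_mul]
    exact congrArg _ (qtr1_lift_mul D (liftn X n) Z)

/-- Transport of operators along an equality of the number of tensor factors. -/
def castOp {m m' : ℕ} (h : m = m') (X : Op N A m) : Op N A m' := h ▸ X

lemma qtr1_castOp {m m' : ℕ} (h : m = m') (X : Op N A (m + 1)) :
    qtr1 D (castOp (congrArg (· + 1) h) X) = castOp h (qtr1 D X) := by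
  subst h; rfl

/-- `X_{i+l-1} ⋯ X_{i+1} X_i`. -/
def chainRev {N : ℕ} (m : ℕ) (X : M2 N A) (i : ℕ) : ℕ → Op N A m
  | 0 => 1
  | l + 1 => site m (i + l) X * chainRev m X i l

lemma lift_chainRev {X : M2 N A} {m p : ℕ} :
    ∀ {n : ℕ}, p + n < m → lift (chainRev m X p n) = chainRev (m + 1) X p n
  | 0, _ => lift_one
  | n + 1, h => by
    rw [chainRev, chainRev, lift_mul, lift_chainRev (by omega), lift_site (by omega)]

lemma chain_mul_chainRev {X Y : M2 N A} (h : X * Y = 1) {m p : ℕ} :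
    ∀ {n : ℕ}, p + n < m → chain m X p n * chainRev m Y p n = 1
  | 0, _ => mul_one 1
  | n + 1, hn => by
    rw [chain, chainRev, mul_assoc, ← mul_assoc (site m _ X), site_mul_inv h (by omega), one_mul,
      chain_mul_chainRev h (by omega)]

/-- Conjugation with `F̂` turns the quantum trace over the last factor into a scalar factor. -/
def TraceTwist (F F' : M2 N A) : Prop :=
  ∀ (m : ℕ) (Z : Op N A (m + 1)),
    qtr1 D (site (m + 2) m F * lift Z * site (m + 2) m F') = lift (qtr1 D Z)

lemma qtrs_conj {F F' : M2 N A} (hF : TraceTwist D F F') {p : ℕ} :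
    ∀ {n : ℕ} (Z : Op N A (p + n)),
      qtrs D (p + 1) n (castOp (add_right_comm p n 1)
        (chain (p + n + 1) F p n * lift Z * chainRev (p + n + 1) F' p n)) = lift (qtrs D p n Z)
  | 0, Z => by
    simp only [chain, chainRev, one_mul, mul_one]; rfl
  | n + 1, Z => by
    have h := hF (p + n) Z
    have e : qtr1 D (chain (p + n + 2) F p (n + 1) * lift Z * chainRev (p + n + 2) F' p (n + 1)) =
        chain (p + n + 1) F p n * lift (qtr1 D Z) * chainRev (p + n + 1) F' p n := by
      rw [← h, ← qtr1_lift_mul, ← qtr1_mul_lift, lift_chain (by omega), lift_chainRev (by omega),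
        chain, chainRev]
      simp only [mul_assoc]
    rw [qtrs, qtrs, ← qtrs_conj hF, ← e]
    exact congrArg _ (qtr1_castOp D (add_right_comm p n 1) _)

lemma castOp_eq_of_forall {m m' : ℕ} (h : m = m') (f : ∀ m, Op N A m) : castOp h (f m) = f m' := by
  subst h; rfl

end PartialTrace

section ClosedBraiding

variable {K : Type*} [Field K] {N : ℕ} {F F' Ψ : M2 N K}

lemma IsClosedPair.sum_mul (h : IsClosedPair F Ψ) (f f' g g' : Fin N) :
    (∑ e, ∑ c, F (g, e) (f, c) * Ψ (c, f') (e, g')) = if f = f' ∧ g = g' then 1 else 0 := by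
  let P : Matrix (Fin N × Fin N) (Fin N × Fin N) K := .of fun i j => Ψ (i.1, j.1) (i.2, j.2)
  let Q : Matrix (Fin N × Fin N) (Fin N × Fin N) K := .of fun i j => F (i.2, j.2) (i.1, j.1)
  have hPQ : P * Q = 1 := by
    ext ⟨a, c⟩ ⟨d, b⟩
    simp only [Matrix.mul_apply, Fintype.sum_prod_type, P, Q, Matrix.of_apply, h a b c d, Matrix.one_apply,
      Prod.mk.injEq, eq_comm (a := b)]
  have hQP : (Q * P) (f, g) (f', g') = (1 : Matrix _ _ K) (f, g) (f', g') := by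
    rw [mul_eq_one_comm.mp hPQ]
  simp only [Matrix.mul_apply, Fintype.sum_prod_type, P, Q, Matrix.of_apply, Matrix.one_apply,
      Prod.mk.injEq] at hQP
  rw [Finset.sum_comm, hQP]

lemma IsClosedPair.sum_Dmat (h : IsClosedPair F Ψ) (x y : Fin N) :
    (∑ c, ∑ e, Dmat Ψ c e * F (x, e) (y, c)) = if x = y then 1 else 0 := by
  have h1 : (∑ c, ∑ e, Dmat Ψ c e * F (x, e) (y, c)) =
      ∑ t, ∑ e, ∑ c, F (x, e) (y, c) * Ψ (c, t) (e, t) := by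
    simp only [Dmat, Finset.sum_mul]
    rw [Finset.sum_comm, Finset.sum_comm_cycle]
    simp only [mul_comm]
  simp only [h1, h.sum_mul]
  rw [Finset.sum_eq_single y (fun t _ ht => if_neg fun h => ht h.1.symm) (by simp)]
  simp

lemma IsClosedPair.cancel (h : IsClosedPair F Ψ) {G H : Fin N → Fin N → K}
    (hGH : ∀ x y, ∑ e, ∑ c, F (x, e) (y, c) * G e c = ∑ e, ∑ c, F (x, e) (y, c) * H e c)
    (e c : Fin N) : G e c = H e c := by
  have key : ∀ G : Fin N → Fin N → K, G e c =
      ∑ f, ∑ g, Ψ (c, f) (e, g) * ∑ b, ∑ d, F (g, b) (f, d) * G b d := fun G => by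
    have h1 : (∑ f, ∑ g, Ψ (c, f) (e, g) * ∑ b, ∑ d, F (g, b) (f, d) * G b d) =
        ∑ b, ∑ d, (∑ f, ∑ g, Ψ (c, f) (e, g) * F (g, b) (f, d)) * G b d := by
      simp only [Finset.mul_sum, Finset.sum_mul, mul_assoc]
      rw [Finset.sum_comm_cycle]
      exact Finset.sum_congr rfl fun b _ => Finset.sum_comm_cycle
    rw [h1]
    simp only [h c _ e _]
    rw [Finset.sum_eq_single e (fun b _ hb => by simp [hb]) (by simp)]
    simp
  rw [key G, key H]
  simp only [hGH]

lemma qtr1_site_last (h : IsClosedPair F Ψ) {A : Type*} [Ring A] [Algebra K A] (m : ℕ) :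
    qtr1 (Dmat Ψ) (site (m + 2) m (F.map (algebraMap K A))) = 1 := by
  ext a b
  rw [← Fin.snoc_init_self a, ← Fin.snoc_init_self b]
  simp only [qtr1, site_last, Matrix.map_apply, mul_ite, mul_zero, ← map_mul]
  by_cases hab : Fin.init a = Fin.init b
  · simp only [hab, if_true, ← map_sum, h.sum_Dmat, Matrix.one_apply]
    simp only [Fin.snoc_inj, true_and]
    split_ifs <;> simp
  · simp only [hab, if_false, Finset.sum_const_zero, Matrix.one_apply]
    simp only [Fin.snoc_inj, hab, false_and, if_false]

lemma qtr1_conj_apply {A : Type*} [Ring A] [Algebra K A] (D : Matrix (Fin N) (Fin N) K)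
    (F F' : M2 N K) {m : ℕ} (Z : Op N A (m + 1)) (a b : Fin m → Fin N) (x y : Fin N) :
    qtr1 D (site (m + 2) m (F.map (algebraMap K A)) * lift Z *
      site (m + 2) m (F'.map (algebraMap K A))) (Fin.snoc a x) (Fin.snoc b y) =
    ∑ u, ∑ w, algebraMap K A (∑ c, ∑ e, ∑ v, D c e * F (x, e) (u, v) * F' (w, v) (y, c)) *
      Z (Fin.snoc a u) (Fin.snoc b w) := by
  simp only [qtr1, Matrix.mul_apply, sum_snoc, site_last, lift_apply_snoc, mul_ite, ite_mul,
    mul_zero, zero_mul, Finset.sum_ite_eq, Finset.sum_ite_eq', Finset.mem_univ, if_true,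
    Finset.sum_ite_irrel, Finset.sum_const_zero, Matrix.map_apply]
  simp only [map_sum, map_mul, Finset.sum_mul, Finset.mul_sum]
  refine (Finset.sum_congr rfl fun c _ => Finset.sum_congr rfl fun e _ =>
    Finset.sum_comm_cycle).trans (Finset.sum_comm_cycle.trans
      (Finset.sum_congr rfl fun u _ => Finset.sum_comm_cycle.trans ?_))
  refine Finset.sum_congr rfl fun w _ => Finset.sum_congr rfl fun c _ =>
    Finset.sum_congr rfl fun e _ => Finset.sum_congr rfl fun v _ => ?_
  simp only [mul_assoc]
  rw [← Algebra.commutes (F' (w, v) (y, c))]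

lemma IsClosedPair.sum_conj (h : IsClosedPair F Ψ) (hF : BraidPair F F') (x y u w : Fin N) :
    (∑ c, ∑ e, ∑ v, Dmat Ψ c e * F (x, e) (u, v) * F' (w, v) (y, c)) =
      if x = y then Dmat Ψ w u else 0 := by
  have hYB : site 3 1 F * lift (site 2 0 F) * site 3 1 F' =
      lift (site 2 0 F') * (site 3 1 F * lift (site 2 0 F)) := by
    have h1 := site_mul_inv hF.mul_inv (m := 3) (i := 1) (by omega)
    have h0 := site_mul_inv hF.inv_mul (m := 3) (i := 0) (by omega)
    rw [lift_site (by omega), lift_site (by omega)]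
    calc site 3 1 F * site 3 0 F * site 3 1 F'
        = site 3 0 F' * site 3 0 F * (site 3 1 F * site 3 0 F * site 3 1 F') := by
          rw [h0, one_mul]
      _ = site 3 0 F' * (site 3 0 F * site 3 1 F * site 3 0 F) * site 3 1 F' := by
          simp only [mul_assoc]
      _ = site 3 0 F' * (site 3 1 F * site 3 0 F) * (site 3 1 F * site 3 1 F') := by
          rw [hF.twist.left]; simp only [mul_assoc]
      _ = _ := by rw [h1, mul_one]
  have htr : qtr1 (Dmat Ψ) (site 3 1 F * lift (site 2 0 F) * site 3 1 F') = 1 := by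
    have h1 := qtr1_site_last (A := K) h 1
    simp only [Algebra.algebraMap_self, RingHom.coe_id, Matrix.map_id] at h1
    rw [hYB, qtr1_lift_mul, qtr1_mul_lift, h1, one_mul, site_mul_inv hF.inv_mul (by omega)]
  refine h.cancel (G := fun u w => ∑ c, ∑ e, ∑ v, Dmat Ψ c e * F (x, e) (u, v) * F' (w, v) (y, c))
    (H := fun u w => if x = y then Dmat Ψ w u else 0) (fun g f => ?_) u w
  have h2 := congrFun (congrFun htr (Fin.snoc (fun _ => g : Fin 1 → Fin N) x))
    (Fin.snoc (fun _ => f : Fin 1 → Fin N) y)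
  have h3 := qtr1_conj_apply (A := K) (Dmat Ψ) F F' (site 2 0 F) (fun _ => g) (fun _ => f) x y
  simp only [Algebra.algebraMap_self, RingHom.coe_id, Matrix.map_id, id] at h3
  rw [h3] at h2
  have h4 : ∀ g f u w : Fin N, site 2 0 F (Fin.snoc (fun _ => g : Fin 1 → Fin N) u)
      (Fin.snoc (fun _ => f : Fin 1 → Fin N) w) = F (g, u) (f, w) := fun g f u w => by
    rw [site_two]; rfl
  simp only [h4] at h2
  simp only [mul_comm (F _ _), h2]
  have h5 := h.sum_Dmat g f
  rw [Finset.sum_comm] at h5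
  have h6 : (1 : Op N K 2) (Fin.snoc (fun _ => g : Fin 1 → Fin N) x)
      (Fin.snoc (fun _ => f : Fin 1 → Fin N) y) = if g = f ∧ x = y then 1 else 0 := by
    rw [Matrix.one_apply]
    exact if_congr (Fin.snoc_inj.trans
      (and_congr_left' ⟨fun h => congrFun h 0, fun h => funext fun _ => h⟩)) rfl rfl
  rw [h6]
  split_ifs with h7 h8 h8
  · rw [h5, if_pos h7.1]
  · exact absurd h7.2 h8
  · rw [h5, if_neg fun h9 => h7 ⟨h9, h8⟩]
  · simp

lemma traceTwist (h : IsClosedPair F Ψ) (hF : BraidPair F F') {A : Type*} [Ring A] [Algebra K A] :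
    TraceTwist (Dmat Ψ) (F.map (algebraMap K A)) (F'.map (algebraMap K A)) := fun m Z => by
  ext a b
  rw [← Fin.snoc_init_self a, ← Fin.snoc_init_self b, qtr1_conj_apply, lift_apply_snoc]
  simp only [h.sum_conj hF]
  split_ifs
  · rw [qtr1, Finset.sum_comm]
  · simp

end ClosedBraiding

section WeightExchange

variable {K : Type*} [Field K] {N : ℕ} {F F' Ψ : M2 N K}

/-- The weight matrix of the quantum trace over two factors. -/
def pairWeight (D : Matrix (Fin N) (Fin N) K) : M2 N K := fun p p' => D p.1 p'.1 * D p.2 p'.2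

lemma sum_vec_four {V : Type*} [AddCommMonoid V] (f : (Fin 4 → Fin N) → V) :
    ∑ d, f d = ∑ x, ∑ y, ∑ z, ∑ t, f ![x, y, z, t] := by
  simp only [sum_snoc]
  rw [Fintype.sum_unique]
  refine Finset.sum_congr rfl fun x _ => Finset.sum_congr rfl fun y _ =>
    Finset.sum_congr rfl fun z _ => Finset.sum_congr rfl fun t _ => congrArg f ?_
  ext i
  fin_cases i <;> rfl

lemma site_four_zero (X : M2 N K) (x y z t x' y' z' t' : Fin N) :
    site 4 0 X ![x, y, z, t] ![x', y', z', t'] =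
      if z = z' ∧ t = t' then X (x, y) (x', y') else 0 := by
  simp [site, Fin.forall_fin_succ]

lemma site_four_one (X : M2 N K) (x y z t x' y' z' t' : Fin N) :
    site 4 1 X ![x, y, z, t] ![x', y', z', t'] =
      if x = x' ∧ t = t' then X (y, z) (y', z') else 0 := by
  simp [site, Fin.forall_fin_succ]

lemma site_four_two (X : M2 N K) (x y z t x' y' z' t' : Fin N) :
    site 4 2 X ![x, y, z, t] ![x', y', z', t'] =
      if x = x' ∧ y = y' then X (z, t) (z', t') else 0 := by
  simp [site, Fin.forall_fin_succ]

lemma site_four_zero_mul (X : M2 N K) (Z : Op N K 4) (x y z t : Fin N) (b : Fin 4 → Fin N) :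
    (site 4 0 X * Z) ![x, y, z, t] b = ∑ u, ∑ v, X (x, y) (u, v) * Z ![u, v, z, t] b := by
  simp [Matrix.mul_apply, sum_vec_four, site_four_zero, ite_and]

lemma site_four_one_mul (X : M2 N K) (Z : Op N K 4) (x y z t : Fin N) (b : Fin 4 → Fin N) :
    (site 4 1 X * Z) ![x, y, z, t] b = ∑ u, ∑ v, X (y, z) (u, v) * Z ![x, u, v, t] b := by
  simp [Matrix.mul_apply, sum_vec_four, site_four_one, ite_and]

lemma site_four_two_mul (X : M2 N K) (Z : Op N K 4) (x y z t : Fin N) (b : Fin 4 → Fin N) :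
    (site 4 2 X * Z) ![x, y, z, t] b = ∑ u, X (z, t) u * Z ![x, y, u.1, u.2] b := by
  simp [Fintype.sum_prod_type, Matrix.mul_apply, sum_vec_four, site_four_two, ite_and]

lemma mul_site_four_two (X : M2 N K) (Z : Op N K 4) (x y z t : Fin N) (a : Fin 4 → Fin N) :
    (Z * site 4 2 X) a ![x, y, z, t] = ∑ u, Z a ![x, y, u.1, u.2] * X u (z, t) := by
  simp [Fintype.sum_prod_type, Matrix.mul_apply, sum_vec_four, site_four_two, ite_and]

/-- The partial trace over the last two of four factors, weighted by `Y`. -/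
def weightedTrace (Y : M2 N K) (Z : Op N K 4) (a₁ a₂ b₁ b₂ : Fin N) : K :=
  ∑ c, ∑ e, Y c e * Z ![a₁, a₂, e.1, e.2] ![b₁, b₂, c.1, c.2]

lemma qtr1_qtr1_apply (D : Matrix (Fin N) (Fin N) K) (Z : Op N K 4) (a₁ a₂ b₁ b₂ : Fin N) :
    qtr1 D (qtr1 D Z) ![a₁, a₂] ![b₁, b₂] = weightedTrace (pairWeight D) Z a₁ a₂ b₁ b₂ := by
  have h : ∀ (x y z t : Fin N), (Fin.snoc (Fin.snoc ![x, y] z : Fin 3 → Fin N) t : Fin 4 → Fin N) =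
      ![x, y, z, t] := fun x y z t => by
    ext i
    fin_cases i <;> rfl
  simp only [qtr1, weightedTrace, pairWeight, h, Fintype.sum_prod_type, Finset.mul_sum,
    Algebra.algebraMap_self, RingHom.id_apply, mul_assoc]
  exact Finset.sum_congr rfl fun c _ => Finset.sum_comm

lemma weightedTrace_site_mul (Y X : M2 N K) (Z : Op N K 4) (a₁ a₂ b₁ b₂ : Fin N) :
    weightedTrace Y (site 4 2 X * Z) a₁ a₂ b₁ b₂ = weightedTrace (Y * X) Z a₁ a₂ b₁ b₂ := by
  simp only [weightedTrace, site_four_two_mul]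
  simp only [Matrix.mul_apply, Finset.mul_sum, Finset.sum_mul, mul_assoc]
  exact Finset.sum_congr rfl fun c _ => Finset.sum_comm

lemma weightedTrace_mul_site (Y X : M2 N K) (Z : Op N K 4) (a₁ a₂ b₁ b₂ : Fin N) :
    weightedTrace Y (Z * site 4 2 X) a₁ a₂ b₁ b₂ = weightedTrace (X * Y) Z a₁ a₂ b₁ b₂ := by
  simp only [weightedTrace, mul_site_four_two]
  simp only [Matrix.mul_apply, Finset.mul_sum, Finset.sum_mul]
  refine (Finset.sum_congr rfl fun c _ => Finset.sum_comm).trans (Finset.sum_comm.trans ?_)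
  refine Finset.sum_congr rfl fun u _ => ?_
  rw [Finset.sum_comm]
  refine Finset.sum_congr rfl fun e _ => Finset.sum_congr rfl fun c _ => ?_
  ring

lemma sum_reorder {ι V : Type*} [Fintype ι] [AddCommMonoid V]
    (f : ι → ι → ι → ι → ι → ι → ι → ι → V) :
    ∑ c₁, ∑ c₂, ∑ e₁, ∑ e₂, ∑ p, ∑ q, ∑ r, ∑ s, f c₁ c₂ e₁ e₂ p q r s =
      ∑ p, ∑ r, ∑ e₁, ∑ q, ∑ s, ∑ c₁, ∑ e₂, ∑ c₂, f c₁ c₂ e₁ e₂ p q r s := by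
  let e : ι × ι × ι × ι × ι × ι × ι × ι ≃ ι × ι × ι × ι × ι × ι × ι × ι :=
    ⟨fun (c₁, c₂, e₁, e₂, p, q, r, s) => (p, r, e₁, q, s, c₁, e₂, c₂),
      fun (p, r, e₁, q, s, c₁, e₂, c₂) => (c₁, c₂, e₁, e₂, p, q, r, s), fun _ => rfl, fun _ => rfl⟩
  have h := Fintype.sum_equiv e (fun (c₁, c₂, e₁, e₂, p, q, r, s) => f c₁ c₂ e₁ e₂ p q r s)
    (fun (p, r, e₁, q, s, c₁, e₂, c₂) => f c₁ c₂ e₁ e₂ p q r s) fun _ => rfl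
  simpa only [Fintype.sum_prod_type] using h

lemma weightedTrace_braid (F Y : M2 N K) (a₁ a₂ b₁ b₂ : Fin N) :
    weightedTrace Y (site 4 1 F * (site 4 0 F * (site 4 2 F * site 4 1 F))) a₁ a₂ b₁ b₂ =
      ∑ p, ∑ r, F (a₁, p) (b₁, r) * ∑ e₁, ∑ q, F (a₂, e₁) (p, q) * ∑ s, ∑ c₁, F (r, s) (b₂, c₁) *
        ∑ e₂, ∑ c₂, F (q, e₂) (s, c₂) * Y (c₁, c₂) (e₁, e₂) := by
  simp only [weightedTrace, site_four_zero_mul, site_four_one_mul, site_four_two_mul,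
    site_four_one, Fintype.sum_prod_type, ite_and, mul_ite, mul_zero, Finset.sum_ite_eq',
    Finset.mem_univ, if_true, Finset.sum_ite_irrel, Finset.sum_const_zero,
    Finset.mul_sum]
  rw [sum_reorder]
  iterate 8 refine Finset.sum_congr rfl fun _ _ => ?_
  ring

lemma IsClosedPair.eq_zero_of_weightedTrace_braid (h : IsClosedPair F Ψ) {Y : M2 N K}
    (hY : ∀ a₁ a₂ b₁ b₂, weightedTrace Y (site 4 1 F * (site 4 0 F * (site 4 2 F * site 4 1 F)))
      a₁ a₂ b₁ b₂ = 0) : Y = 0 := by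
  have cancel : ∀ {G : Fin N → Fin N → K}, (∀ x y, ∑ e, ∑ c, F (x, e) (y, c) * G e c = 0) →
      ∀ e c, G e c = 0 := fun hG e c =>
    h.cancel (H := fun _ _ => 0) (fun x y => by simpa using hG x y) e c
  simp only [weightedTrace_braid] at hY
  ext ⟨c₁, c₂⟩ ⟨e₁, e₂⟩
  have h1 := fun p r a₂ b₂ => cancel (fun a₁ b₁ => hY a₁ a₂ b₁ b₂) p r
  have h2 := fun e₁ q r b₂ => cancel (fun a₂ p => h1 p r a₂ b₂) e₁ q
  have h3 := fun s c₁ e₁ q => cancel (fun r b₂ => h2 e₁ q r b₂) s c₁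
  exact cancel (fun q s => h3 s c₁ e₁ q) e₂ c₂

lemma weightedTrace_sub (Y Y' : M2 N K) (Z : Op N K 4) (a₁ a₂ b₁ b₂ : Fin N) :
    weightedTrace (Y - Y') Z a₁ a₂ b₁ b₂ =
      weightedTrace Y Z a₁ a₂ b₁ b₂ - weightedTrace Y' Z a₁ a₂ b₁ b₂ := by
  simp only [weightedTrace, Matrix.sub_apply, sub_mul, Finset.sum_sub_distrib]

/-- The weights of the quantum trace intertwine an `R`-matrix and its double twist. -/
lemma pairWeight_exchange (h : IsClosedPair F Ψ) (hF : BraidPair F F') {R G : M2 N K}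
    (hR : Twist F R) (hG : Twist F G) (hGF : G * (F * F) = F * F * R) :
    pairWeight (Dmat Ψ) * R = G * pairWeight (Dmat Ψ) := by
  set W : Op N K 4 := site 4 1 F * (site 4 0 F * (site 4 2 F * site 4 1 F)) with hW
  have h02 : site 4 0 F * site 4 2 F = site 4 2 F * site 4 0 F :=
    (site_commute (by omega) (by omega) fun a b c d => hF.central _ _ _).eq
  have hW' : W = site 4 1 F * site 4 2 F * (site 4 0 F * site 4 1 F) := by
    rw [hW, ← mul_assoc (site 4 0 F), h02]; simp only [mul_assoc]
  have hRW : site 4 2 R * W = W * site 4 0 R := by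
    have e1 := hR.site_right (m := 4) (i := 1) (by omega)
    have e0 := hR.site_right (m := 4) (i := 0) (by omega)
    calc site 4 2 R * W = site 4 2 R * site 4 1 F * site 4 2 F * (site 4 0 F * site 4 1 F) := by
          rw [hW']; simp only [mul_assoc]
      _ = site 4 1 F * site 4 2 F * (site 4 1 R * site 4 0 F * site 4 1 F) := by
          rw [← e1]; simp only [mul_assoc]
      _ = W * site 4 0 R := by rw [← e0, hW']; simp only [mul_assoc]
  have hGW : site 4 0 G * W = W * site 4 2 G := by
    have e1 := hG.site_left (m := 4) (i := 1) (by omega)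
    have e0 := hG.site_left (m := 4) (i := 0) (by omega)
    calc site 4 0 G * W = site 4 0 G * site 4 1 F * site 4 0 F * (site 4 2 F * site 4 1 F) := by
          rw [hW]; simp only [mul_assoc]
      _ = site 4 1 F * site 4 0 F * (site 4 1 G * site 4 2 F * site 4 1 F) := by
          rw [e0]; simp only [mul_assoc]
      _ = W * site 4 2 G := by rw [e1, hW]; simp only [mul_assoc]
  have t : ∀ m, qtr1 (Dmat Ψ) (site (m + 2) m F) = 1 := fun m => by
    simpa only [Algebra.algebraMap_self, RingHom.coe_id, Matrix.map_id] using
      qtr1_site_last (A := K) h m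
  have hl : ∀ X : M2 N K, lift (lift (site 2 0 X)) = site 4 0 X := fun X => by
    rw [lift_site (by omega), lift_site (by omega)]
  have hWt : qtr1 (Dmat Ψ) (qtr1 (Dmat Ψ) W) = site 2 0 (F * F) := by
    have e : W = lift (site 3 1 F * site 3 0 F) * (site 4 2 F * lift (site 3 1 F)) := by
      rw [lift_mul, lift_site (by omega), lift_site (by omega), hW, mul_assoc]
    have e' : site 3 1 F * site 3 0 F * site 3 1 F =
        lift (site 2 0 F) * (site 3 1 F * lift (site 2 0 F)) := by
      rw [lift_site (by omega), ← hF.twist.left, mul_assoc]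
    rw [e, qtr1_lift_mul, qtr1_mul_lift, t, one_mul, e', qtr1_lift_mul, qtr1_mul_lift, t, one_mul,
      site_mul (by omega)]
  have key : qtr1 (Dmat Ψ) (qtr1 (Dmat Ψ) (site 4 2 R * W)) =
      qtr1 (Dmat Ψ) (qtr1 (Dmat Ψ) (W * site 4 2 G)) := by
    rw [hRW, ← hGW, ← hl, ← hl, qtr1_mul_lift, qtr1_mul_lift, qtr1_lift_mul, qtr1_lift_mul, hWt,
      ← site_mul (by omega), ← site_mul (by omega), hGF]
  refine sub_eq_zero.mp (h.eq_zero_of_weightedTrace_braid fun a₁ a₂ b₁ b₂ => ?_)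
  rw [weightedTrace_sub, ← weightedTrace_site_mul, ← weightedTrace_mul_site, ← qtr1_qtr1_apply,
    ← qtr1_qtr1_apply, key, sub_self]

/-- The weight matrix of the quantum trace over all factors. -/
def traceWeight (D : Matrix (Fin N) (Fin N) K) (m : ℕ) : Op N K m := fun a b => ∏ i, D (a i) (b i)

lemma traceWeight_snoc (D : Matrix (Fin N) (Fin N) K) {m : ℕ} (a b : Fin m → Fin N)
    (x y : Fin N) : traceWeight D (m + 1) (Fin.snoc a x) (Fin.snoc b y) =
      traceWeight D m a b * D x y := by
  simp only [traceWeight, Fin.prod_univ_castSucc, Fin.snoc_castSucc, Fin.snoc_last]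

lemma traceWeight_mul_site {D : Matrix (Fin N) (Fin N) K} {R G : M2 N K}
    (h : pairWeight D * R = G * pairWeight D) {m i : ℕ} (hi : i + 1 < m) :
    traceWeight D m * site m i R = site m i G * traceWeight D m := by
  induction m, hi using Nat.le_induction with
  | base =>
    ext a b
    rw [← Fin.snoc_init_self a, ← Fin.snoc_init_self b, ← Fin.snoc_init_self (Fin.init a),
      ← Fin.snoc_init_self (Fin.init b)]
    generalize Fin.init (Fin.init a) = a', Fin.init (Fin.init b) = b'
    generalize Fin.init a (Fin.last _) = x, a (Fin.last _) = e, Fin.init b (Fin.last _) = y,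
      b (Fin.last _) = c
    have h1 := congrFun (congrFun h (x, e)) (y, c)
    simp only [Matrix.mul_apply, Fintype.sum_prod_type, pairWeight] at h1
    simp only [Matrix.mul_apply, sum_snoc, site_last, traceWeight_snoc]
    simp only [mul_ite, ite_mul, mul_zero, zero_mul, Finset.sum_ite_irrel, Finset.sum_const_zero,
      Finset.sum_ite_eq, Finset.sum_ite_eq', Finset.mem_univ, if_true]
    have h2 := congrArg (traceWeight D i a' b' * ·) h1
    simp only [Finset.mul_sum] at h2
    refine Eq.trans ?_ (h2.trans ?_) <;>
      exact Finset.sum_congr rfl fun _ _ => Finset.sum_congr rfl fun _ _ => by ring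
  | succ m hm ih =>
    ext a b
    have h1 := congrFun (congrFun ih (Fin.init a)) (Fin.init b)
    rw [← Fin.snoc_init_self a, ← Fin.snoc_init_self b, ← lift_site (by omega),
      ← lift_site (by omega)]
    simp only [Matrix.mul_apply] at h1
    simp only [Matrix.mul_apply, sum_snoc, lift_apply_snoc, traceWeight_snoc, mul_ite, ite_mul,
      mul_zero, zero_mul, Finset.sum_ite_eq, Finset.sum_ite_eq', Finset.mem_univ, if_true,
      mul_right_comm _ (D _ _)]
    simp only [← mul_assoc, ← Finset.sum_mul, h1]

end WeightExchange

section SymmetricFunctions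

lemma symz_algHom {K B B' : Type*} [Field K] [Ring B] [Algebra K B] [Ring B'] [Algebra K B']
    (g : B →ₐ[K] B') {q : K} {r : ℕ → B} :
    ∀ n : ℕ, g (symz q r n) = symz q (fun i => g (r i)) n
  | 0 => map_one g
  | 1 => map_one g
  | n + 2 => by
    simp only [symz, map_smul, map_mul, map_add, map_one, symz_algHom g (n + 1)]

variable {K : Type*} [Field K] {A : Type*} [Ring A] [Algebra K A] {N : ℕ}

variable (K A N) in
/-- Adding a tensor factor on the right, as an algebra homomorphism. -/
noncomputable def liftHom (m : ℕ) : Op N A m →ₐ[K] Op N A (m + 1) :=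
  AlgHom.ofLinearMap
    { toFun := lift
      map_add' := fun X Y => by
        ext a b
        simp only [lift, emb, Matrix.add_apply]
        split_ifs <;> simp
      map_smul' := fun c X => by
        ext a b
        simp only [lift, emb, Matrix.smul_apply, RingHom.id_apply]
        split_ifs <;> simp }
    lift_one lift_mul

lemma lift_symz {q : K} {X : M2 N A} {m p n : ℕ} (h : p + n ≤ m) :
    lift (symz q (fun i => site m (p + i) X) n) = symz q (fun i => site (m + 1) (p + i) X) n :=
  (symz_algHom (liftHom K A N m) n).trans (symz_congr fun i hi => lift_site (by omega) X)

lemma qsym_eq_symz (q : K) (R : M2 N K) (m p : ℕ) :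
    ∀ n, qsym q R m p n = symz q (fun i => site m (p + i) R) n
  | 0 => rfl
  | 1 => rfl
  | n + 2 => by rw [qsym, symz, qsym_eq_symz q R m p (n + 1)]

lemma symz_site_map (q : K) (R : M2 N K) (m p n : ℕ) :
    (symz q (fun i => site m (p + i) R) n).map (algebraMap K A) =
      symz q (fun i => site m (p + i) (R.map (algebraMap K A))) n := by
  have h := symz_algHom (q := q) (r := fun i => site m (p + i) R)
    ((Algebra.ofId K A).mapMatrix : Op N K m →ₐ[K] Op N A m) n
  refine h.trans (symz_congr fun i _ => ?_)
  exact (site_map (algebraMap K A) m (p + i) R).symm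

lemma chain_eq_prodSeq (X : M2 N A) (m : ℕ) :
    ∀ l, chain m X 0 l = prodSeq (fun i => site m i X) l
  | 0 => rfl
  | l + 1 => by rw [chain, prodSeq, chain_eq_prodSeq X m l, zero_add]

lemma chain_map {B : Type*} [Ring B] (f : A →+* B) (X : M2 N A) (m p : ℕ) :
    ∀ l, (chain m X p l).map f = chain m (X.map f) p l
  | 0 => by simp [chain]
  | l + 1 => by rw [chain, chain, Matrix.map_mul, chain_map f X m p l, site_map]

lemma heckeSeq_site {q : K} {R : M2 N K} (h : YB R) (hR : R * R = 1 + (q - q⁻¹) • R) (m : ℕ) :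
    HeckeSeq q (fun i => site m i R) m where
  hecke i hi := by rw [← site_mul hi, hR, site_add hi, site_one hi, site_smul hi]
  braid i hi := (twist_self h).site_left hi
  comm i j hij hj := site_commute hij hj fun a b c d => Commute.all _ _

lemma centralEntries_map (X : M2 N K) : CentralEntries (X.map (algebraMap K A)) :=
  fun _ _ _ => Algebra.commutes _ _

variable {q : K} {R F F' : M2 N A} {M : Matrix (Fin N) (Fin N) A}

/-- The operator `S^{(n)} M_{\overline{p+1}} ⋯ M_{\overline{p+n}}` on the factors after `p`. -/
noncomputable def symOp (q : K) (R F F' : M2 N A) (M : Matrix (Fin N) (Fin N) A) (p n m : ℕ) :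
    Op N A m :=
  symz q (fun i => site m (p + i) R) n * MbarSeg m F F' M p n

lemma lift_symOp {p n m : ℕ} (h : p + n ≤ m) :
    lift (symOp q R F F' M p n m) = symOp q R F F' M p n (m + 1) := by
  rw [symOp, lift_mul, lift_symz h, lift_MbarSeg h, symOp]

lemma chain_conj_symOp (hF : BraidPair F F') (hR : Twist F R) {p n m : ℕ} (h : p + n < m) :
    chain m F p n * symOp q R F F' M p n m * chainRev m F' p n =
      symOp q R F F' M (p + 1) n m := by
  have h1 : SemiconjBy (chain m F p n) (symOp q R F F' M p n m) (symOp q R F F' M (p + 1) n m) :=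
    (semiconj_symz fun i hi => semiconj_chain_site hF hR hi h).mul_right
      (semiconj_MbarSeg fun j hj => semiconj_chain_Mbar hF hj h)
  rw [h1.eq, mul_assoc, chain_mul_chainRev hF.mul_inv h, mul_one]

variable {D : Matrix (Fin N) (Fin N) K}

lemma qtrs_symOp (hF : BraidPair F F') (hR : Twist F R) (hD : TraceTwist D F F') (n : ℕ) :
    ∀ p, qtrs D p n (symOp q R F F' M p n (p + n)) =
      Matrix.diagonal fun _ => qtrAll D (symOp q R F F' M 0 n n)
  | 0 => by
    have h1 : qtrAll D (symOp q R F F' M 0 n (0 + n)) = qtrAll D (symOp q R F F' M 0 n n) :=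
      congrArg (fun m => qtrAll D (symOp q R F F' M 0 n m)) (zero_add n)
    rw [← h1, ← qtrAll_qtrs]
    ext a b
    obtain rfl := Subsingleton.elim a b
    rw [Matrix.diagonal_apply_eq, qtrAll, Fintype.sum_unique, Fintype.sum_unique]
    simp only [Finset.univ_eq_empty, Finset.prod_empty, map_one, one_mul]
    congr 1 <;> exact Subsingleton.elim _ _
  | p + 1 => by
    have h1 := qtrs_conj D hD (symOp q R F F' M p n (p + n))
    rw [lift_symOp le_rfl, chain_conj_symOp hF hR (by omega), qtrs_symOp hF hR hD n p,
      lift_diagonal, castOp_eq_of_forall] at h1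
    exact h1

lemma liftn_chain_mul_MbarSeg (X : M2 N A) (l : ℕ) : ∀ i,
    liftn (chain (l + 1) X 0 l * MbarSeg (l + 1) F F' M 0 (l + 1)) i =
      chain (l + 1 + i) X 0 l * MbarSeg (l + 1 + i) F F' M 0 (l + 1)
  | 0 => rfl
  | i + 1 => by
    rw [liftn, liftn_chain_mul_MbarSeg X l i, lift_mul]
    exact congrArg₂ (· * ·) (lift_chain (m := l + 1 + i) (by omega))
      (lift_MbarSeg (m := l + 1 + i) (by omega))

/-- Quantum traces of products on disjoint sets of factors multiply. -/
lemma qtrAll_chain_mul_symz (hF : BraidPair F F') (hR : Twist F R) (hRc : CentralEntries R)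
    (hD : TraceTwist D F F') (l i : ℕ) :
    qtrAll D (chain (l + 1 + i) R 0 l * symz q (fun j => site (l + 1 + i) (l + 1 + j) R) i *
        MbarSeg (l + 1 + i) F F' M 0 (l + 1 + i)) =
      qtrAll D (chain (l + 1) R 0 l * MbarSeg (l + 1) F F' M 0 (l + 1)) *
        qtrAll D (symOp q R F F' M 0 i i) := by
  have hc : SemiconjBy (symz q (fun j => site (l + 1 + i) (l + 1 + j) R) i)
      (MbarSeg (l + 1 + i) F F' M 0 (l + 1)) (MbarSeg (l + 1 + i) F F' M 0 (l + 1)) :=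
    semiconj_MbarSeg fun j hj => (commute_symz fun j' hj' =>
      (commute_Mbar_of_lt hRc (by omega) (by omega)).symm).symm
  have e : chain (l + 1 + i) R 0 l * symz q (fun j => site (l + 1 + i) (l + 1 + j) R) i *
        MbarSeg (l + 1 + i) F F' M 0 (l + 1 + i) =
      liftn (chain (l + 1) R 0 l * MbarSeg (l + 1) F F' M 0 (l + 1)) i *
        symOp q R F F' M (l + 1) i (l + 1 + i) := by
    rw [MbarSeg_add, liftn_chain_mul_MbarSeg, symOp, zero_add, mul_assoc, ← mul_assoc (symz _ _ _),
      hc.eq]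
    simp only [mul_assoc]
  rw [e, ← qtrAll_qtrs, qtrs_liftn_mul, qtrs_symOp hF hR hD, qtrAll_mul_diagonal]

lemma qtrAll_eq_trace {m : ℕ} (Z : Op N A m) :
    qtrAll D Z = ((traceWeight D m).map (algebraMap K A) * Z).trace := by
  simp only [qtrAll, Matrix.trace, Matrix.diag, Matrix.mul_apply, Matrix.map_apply, traceWeight]

lemma trace_mul_map_comm {ι : Type*} [Fintype ι] (X : Matrix ι ι K) (Z : Matrix ι ι A) :
    (Z * X.map (algebraMap K A)).trace = (X.map (algebraMap K A) * Z).trace := by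
  simp only [Matrix.trace, Matrix.diag, Matrix.mul_apply, Matrix.map_apply]
  rw [Finset.sum_comm]
  simp only [Algebra.commutes]

/-- `X ↦ Tr_F(1,…,m)(X Z)` for operators `X` with scalar entries. -/
noncomputable def traceAgainst (D : Matrix (Fin N) (Fin N) K) {m : ℕ} (Z : Op N A m) :
    Op N K m →ₗ[K] A where
  toFun X := qtrAll D (X.map (algebraMap K A) * Z)
  map_add' X Y := by
    rw [Matrix.map_add _ (map_add _), add_mul]
    simp only [qtrAll_eq_trace, mul_add, Matrix.trace_add]
  map_smul' c X := by
    have h : (c • X).map (algebraMap K A) = c • X.map (algebraMap K A) := by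
      ext a b
      simp only [Matrix.map_apply, Matrix.smul_apply, smul_eq_mul, map_mul]
      rw [Algebra.smul_def]
    rw [h, Matrix.smul_mul]
    simp only [qtrAll_eq_trace, Matrix.mul_smul, Matrix.trace_smul, RingHom.id_apply]

lemma traceAgainst_cyclic {m : ℕ} {Z : Op N A m} {X Y : Op N K m}
    (hZ : X.map (algebraMap K A) * Z = Z * Y.map (algebraMap K A))
    (hD : traceWeight D m * X = Y * traceWeight D m) (W : Op N K m) :
    traceAgainst D Z (X * W) = traceAgainst D Z (W * X) := by
  have h1 : (traceWeight D m).map (algebraMap K A) * X.map (algebraMap K A) =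
      Y.map (algebraMap K A) * (traceWeight D m).map (algebraMap K A) := by
    rw [← Matrix.map_mul, hD, Matrix.map_mul]
  simp only [traceAgainst, LinearMap.coe_mk, AddHom.coe_mk, qtrAll_eq_trace, Matrix.map_mul]
  calc _ = (Y.map (algebraMap K A) * ((traceWeight D m).map (algebraMap K A) *
        (W.map (algebraMap K A) * Z))).trace := by simp only [← mul_assoc, h1]
    _ = _ := by rw [← trace_mul_map_comm]; simp only [mul_assoc, hZ]

end SymmetricFunctions

/-- Newton relations, symmetric form.  For a Hecke R-matrix
`R̂`, a compatible closed R-matrix `F̂` and a matrix of generators `M` of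
`M(R̂,F̂)`:  for every `k = j+1 ≥ 1`,
`k_q τ_k(M) = ∑_{i=0}^{k−1} q^{−i} s_{k−i}(M) τ_i(M)` in `A`. -/
theorem Newton_symmetric {K : Type} [Field K] {A : Type} [Ring A] [Algebra K A]
    {N : ℕ} (q : K) (R F Ψ : M2 N K) (M : Matrix (Fin N) (Fin N) A)
    (hq0 : q ≠ 0) (hq1 : q ^ 2 ≠ 1) (hqn : ∀ n : ℕ, 1 ≤ n → qInt q n ≠ 0)
    (hH : IsHecke q R) (hF : IsUnit F) (hΨ : IsClosedPair F Ψ)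
    (h : Compatible R F) (hM : IsGenerators R F M) :
    ∀ j : ℕ,
      (qInt q (j + 1)) • tauF q R F Ψ M (j + 1) =
        ∑ i ∈ Finset.range (j + 1),
          ((q⁻¹) ^ i) • (sF R F Ψ M (j + 1 - i) * tauF q R F Ψ M i) := by
  intro j
  have hd : q - q⁻¹ ≠ 0 := fun h0 => hq1 (by
    rw [sub_eq_zero] at h0
    rw [sq]; nth_rw 2 [h0]; exact mul_inv_cancel₀ hq0)
  have hdet : IsUnit F.det := (Matrix.isUnit_iff_isUnit_det F).mp hF
  have hF1 : F * F⁻¹ = 1 := Matrix.mul_nonsing_inv F hdet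
  have hF2 : F⁻¹ * F = 1 := Matrix.nonsing_inv_mul F hdet
  obtain ⟨-, hYB, hl, hr⟩ := h
  have hFF : Twist F F := twist_self hYB
  have hFF' : Twist F F⁻¹ := hFF.inv hF1 hF2
  have hRF : Twist F R := ⟨hl, hr⟩
  have hGF : Twist F (RFF R F) := (hFF.mul ((hFF.mul hRF).mul hFF')).mul hFF'
  have hB : BraidPair F F⁻¹ := ⟨hF1, hF2, fun _ _ _ => Commute.all _ _, hFF⟩
  set φ := algebraMap K A with hφ
  have hBA : BraidPair (F.map φ) (F⁻¹.map φ) :=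
    ⟨by rw [← Matrix.map_mul, hF1]; simp, by rw [← Matrix.map_mul, hF2]; simp,
      centralEntries_map F, hFF.map φ⟩
  have hTT := traceTwist hΨ hB (A := A)
  have hexch : pairWeight (Dmat Ψ) * R = RFF R F * pairWeight (Dmat Ψ) :=
    pairWeight_exchange hΨ hB hRF hGF (by
      simp only [RFF, mul_assoc]
      rw [← mul_assoc F⁻¹ F F, hF2, one_mul, hF2, mul_one])
  have htau : ∀ i, tauF q R F Ψ M i =
      qtrAll (Dmat Ψ) (symOp q (R.map φ) (F.map φ) (F⁻¹.map φ) M 0 i i) := fun i => by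
    rw [tauF, qsym_eq_symz, symz_site_map, symOp]
  have key := newton_of_cyclic
    (traceAgainst (Dmat Ψ) (MbarSeg (j + 1) (F.map φ) (F⁻¹.map φ) M 0 (j + 1))) hq0 hd hqn
    (heckeSeq_site hH.2.1 hH.2.2 (j + 1))
    (fun i hi X => traceAgainst_cyclic (by
      rw [← site_map, ← site_map]
      exact MbarSeg_exchange hBA (hRF.map φ) (hGF.map φ) (centralEntries_map R)
        (centralEntries_map _) hM hi) (traceWeight_mul_site hexch hi) X) j 0 (zero_add _)
  have hterm : ∀ l i, l + 1 + i = j + 1 →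
      traceAgainst (Dmat Ψ) (MbarSeg (j + 1) (F.map φ) (F⁻¹.map φ) M 0 (j + 1))
        (prodSeq (fun i => site (j + 1) i R) l *
          symz q (fun t => site (j + 1) (l + 1 + t) R) i) =
      sF R F Ψ M (l + 1) * tauF q R F Ψ M i := by
    rintro l i hli
    rw [← hli, ← chain_eq_prodSeq, htau, sF,
      ← qtrAll_chain_mul_symz hBA (hRF.map φ) (centralEntries_map R) hTT]
    simp only [traceAgainst, LinearMap.coe_mk, AddHom.coe_mk, Matrix.map_mul, chain_map]
    rw [symz_site_map]
  have hleft : traceAgainst (Dmat Ψ) (MbarSeg (j + 1) (F.map φ) (F⁻¹.map φ) M 0 (j + 1))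
      (prodSeq (fun i => site (j + 1) i R) 0 *
        symz q (fun t => site (j + 1) (0 + t) R) (j + 1)) = tauF q R F Ψ M (j + 1) := by
    rw [htau, prodSeq, one_mul, symOp, ← symz_site_map]
    rfl
  rw [hleft] at key
  rw [key]
  refine Finset.sum_congr rfl fun i hi => congrArg _ ?_
  have hi' := Finset.mem_range.mp hi
  obtain ⟨l, hl⟩ : ∃ l, l + 1 = j + 1 - i := ⟨j - i, by omega⟩
  rw [← hl, ← hterm l i (by omega), Nat.add_sub_cancel]

end CHN
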